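/- Let d ≥ 1, T > 0 and let a : [0,T]×ℝ^d → [0,∞) be a Borel function. Let z₁, z₂ : [0,T] → 𝓜(ℝ^d) be maps into the finite signed Borel measures on ℝ^d, each continuous with respect to the weak topology on measures, and let z⁰ ∈ 𝓜(ℝ^d). Suppose both z₁ and z₂ solve ∂_t z = Δ(a z) in the sense of distributions with initial condition z(0,·) = z⁰. Assume that z := z₁ − z₂ admits for almost every t ∈ [0,T] a density z(t,·) with z ∈ L¹_loc([0,T]×ℝ^d), and that (i) ∫_{[0,T]×ℝ^d} |z(t,x)|² dt dx < ∞ and (ii) ∫_{[0,T]×ℝ^d} |a(t,x) z(t,x)|² dt dx < ∞. Then z₁(t) = z₂(t) for every t ∈ [0,T]. -/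

import Mathlib

open MeasureTheory Set

/-- Integral of a real function against a finite signed Borel measure, defined through the
Jordan decomposition. -/
noncomputable def sintegral {α : Type*} [MeasurableSpace α]
    (μ : MeasureTheory.SignedMeasure α) (f : α → ℝ) : ℝ :=
  (∫ x, f x ∂μ.toJordanDecomposition.posPart) - ∫ x, f x ∂μ.toJordanDecomposition.negPart

/-- The Laplacian Δφ = ∑ᵢ ∂²φ/∂xᵢ² of a function on ℝ^d. -/
noncomputable def lap {d : ℕ} (φ : EuclideanSpace ℝ (Fin d) → ℝ)
    (x : EuclideanSpace ℝ (Fin d)) : ℝ :=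
  ∑ i : Fin d, iteratedFDeriv ℝ 2 φ x ![EuclideanSpace.single i 1, EuclideanSpace.single i 1]


open Filter Topology ProbabilityTheory

/-- The value of a signed measure in terms of its Jordan decomposition. -/
lemma signedMeasure_apply_eq_real_sub {α : Type*} [MeasurableSpace α] (z : SignedMeasure α)
    {A : Set α} (hA : MeasurableSet A) :
    z A = z.toJordanDecomposition.posPart.real A - z.toJordanDecomposition.negPart.real A := by
  conv_lhs => rw [← SignedMeasure.toSignedMeasure_toJordanDecomposition z]
  exact Measure.toSignedMeasure_sub_apply hA

/-- A family of signed measures tested against bounded continuous functions in a continuous way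
is setwise measurable. -/
lemma measurable_apply_of_continuous_sintegral {E : Type*} [PseudoEMetricSpace E]
    [MeasurableSpace E] [BorelSpace E] {z : ℝ → SignedMeasure E}
    (hz : ∀ φ : BoundedContinuousFunction E ℝ, Continuous fun s => sintegral (z s) φ)
    {A : Set E} (hA : MeasurableSet A) : Measurable fun s => z s A := by
  have key : ∀ C : Set E, IsClosed C → Measurable fun s => z s C := by
    intro C hC
    have hpos : ∀ n : ℕ, 0 < 1 / ((n : ℝ) + 1) := fun n => by positivity
    let φ : ℕ → BoundedContinuousFunction E ℝ := fun n =>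
      BoundedContinuousFunction.comp _ (LipschitzWith.of_dist_le_mul (K := 1)
        (f := ((↑) : NNReal → ℝ)) (fun x y => by simp [NNReal.dist_eq, Real.dist_eq]))
        (thickenedIndicator (hpos n) C)
    refine measurable_of_tendsto_metrizable (f := fun n s => sintegral (z s) (φ n))
      (fun n => (hz (φ n)).measurable) (tendsto_pi_nhds.2 fun s => ?_)
    have hlim : ∀ x, Tendsto (fun n => φ n x) atTop (𝓝 (C.indicator (fun _ => (1 : ℝ)) x)) := by
      intro x
      have h := tendsto_pi_nhds.1 (thickenedIndicator_tendsto_indicator_closure hpos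
        tendsto_one_div_add_atTop_nhds_zero_nat C) x
      rw [hC.closure_eq] at h
      have h2 := (NNReal.continuous_coe.tendsto _).comp h
      by_cases hx : x ∈ C <;> simpa [hx, φ, Function.comp_def] using h2
    have h_int : ∀ μ : Measure E, IsFiniteMeasure μ →
        Tendsto (fun n => ∫ x, φ n x ∂μ) atTop (𝓝 (μ.real C)) := by
      intro μ hμ
      rw [← integral_indicator_one hC.measurableSet]
      refine tendsto_integral_of_dominated_convergence (fun _ => 1)
        (fun n => (φ n).continuous.aestronglyMeasurable) (integrable_const _)
        (fun n => Eventually.of_forall fun x => ?_) (Eventually.of_forall hlim)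
      simpa [φ] using thickenedIndicator_le_one (hpos n) C x
    rw [signedMeasure_apply_eq_real_sub _ hC.measurableSet]
    exact (h_int _ inferInstance).sub (h_int _ inferInstance)
  induction A, hA using MeasurableSpace.induction_on_inter
    ((BorelSpace.measurable_eq (α := E)).trans borel_eq_generateFrom_isClosed)
    isPiSystem_isClosed with
  | empty => simp
  | basic t ht => exact key t ht
  | compl t ht ih =>
    have : ∀ s, z s tᶜ = z s univ - z s t := fun s => by
      rw [compl_eq_univ_sdiff, VectorMeasure.of_sdiff ht MeasurableSet.univ (subset_univ t)]
    simp_rw [this]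
    exact (key univ isClosed_univ).sub ih
  | iUnion f hd hf ih =>
    refine measurable_of_tendsto_metrizable
      (f := fun n s => ∑ i ∈ Finset.range n, z s (f i))
      (fun n => Finset.measurable_fun_sum _ fun i _ => ih i) (tendsto_pi_nhds.2 fun s => ?_)
    exact (VectorMeasure.hasSum_of_disjoint_iUnion hf hd).tendsto_sum_nat

/-- The positive part of a signed measure is a supremum over any algebra generating the
`σ`-algebra. -/
lemma posPart_apply_eq_iSup {α : Type*} [m : MeasurableSpace α] (z : SignedMeasure α)
    {𝒜 : Set (Set α)} (h𝒜 : IsSetAlgebra 𝒜) (hgen : m = MeasurableSpace.generateFrom 𝒜)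
    {A : Set α} (hA : MeasurableSet A) :
    z.toJordanDecomposition.posPart A = ⨆ B ∈ 𝒜, ENNReal.ofReal (z (A ∩ B)) := by
  set p := z.toJordanDecomposition.posPart
  set n := z.toJordanDecomposition.negPart
  have hmeas : ∀ B ∈ 𝒜, MeasurableSet B := fun B hB => by
    rw [hgen]; exact MeasurableSpace.measurableSet_generateFrom hB
  apply le_antisymm
  · obtain ⟨S, hS, hpS, hnS⟩ := z.toJordanDecomposition.mutuallySingular
    refine ENNReal.le_of_forall_pos_le_add fun ε hε _ => ?_
    obtain ⟨B, hB, hBε⟩ := (Measure.MeasureDense.of_generateFrom_isSetAlgebra_finite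
      (p + n) h𝒜 hgen).approx Sᶜ hS.compl (measure_ne_top _ _) ε (by exact_mod_cast hε)
    have hBm := hmeas B hB
    have hreal : p.real A ≤ z (A ∩ B) + ε := by
      rw [signedMeasure_apply_eq_real_sub z (hA.inter hBm)]
      have h1 : p.real A ≤ p.real (A ∩ B) + p.real (symmDiff Sᶜ B) := by
        calc p.real A ≤ p.real (((A ∩ B) ∪ symmDiff Sᶜ B) ∪ S) := by
              refine measureReal_mono (fun x hx => ?_)
              by_cases hxS : x ∈ S <;> by_cases hxB : x ∈ B <;>
                simp [hxS, hxB, hx, mem_symmDiff]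
          _ ≤ p.real ((A ∩ B) ∪ symmDiff Sᶜ B) + p.real S := measureReal_union_le _ _
          _ ≤ _ := by
              have : p.real S = 0 := by simp [Measure.real, p, hpS]
              rw [this, add_zero]; exact measureReal_union_le _ _
      have h2 : n.real (A ∩ B) ≤ n.real (symmDiff Sᶜ B) := by
        calc n.real (A ∩ B) ≤ n.real (symmDiff Sᶜ B ∪ Sᶜ) := by
              refine measureReal_mono (fun x hx => ?_)
              by_cases hxS : x ∈ S <;> simp [hxS, hx.2, mem_symmDiff]
          _ ≤ n.real (symmDiff Sᶜ B) + n.real Sᶜ := measureReal_union_le _ _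
          _ = _ := by
              have : n.real Sᶜ = 0 := by simp [Measure.real, n, hnS]
              rw [this, add_zero]
      have h3 : p.real (symmDiff Sᶜ B) + n.real (symmDiff Sᶜ B) ≤ ε := by
        rw [← measureReal_add_apply, Measure.real]
        exact ENNReal.toReal_le_of_le_ofReal (by positivity) hBε.le
      change p.real A ≤ p.real (A ∩ B) - n.real (A ∩ B) + ε
      linarith
    calc p A = ENNReal.ofReal (p.real A) := by simp
      _ ≤ ENNReal.ofReal (z (A ∩ B) + ε) := ENNReal.ofReal_le_ofReal hreal
      _ ≤ ENNReal.ofReal (z (A ∩ B)) + ENNReal.ofReal ε := ENNReal.ofReal_add_le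
      _ ≤ _ := by
        gcongr
        · exact le_iSup₂ (f := fun B _ => ENNReal.ofReal (z (A ∩ B))) B hB
        · simp
  · refine iSup₂_le fun B hB => ?_
    rw [signedMeasure_apply_eq_real_sub z (hA.inter (hmeas B hB))]
    calc _ ≤ ENNReal.ofReal (p.real A) := by
          apply ENNReal.ofReal_le_ofReal
          have h1 : p.real (A ∩ B) ≤ p.real A := measureReal_mono inter_subset_left
          have h2 : 0 ≤ n.real (A ∩ B) := measureReal_nonneg
          change p.real (A ∩ B) - n.real (A ∩ B) ≤ p.real A
          linarith
      _ = p A := by simp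

/-- The positive part of a setwise measurable family of signed measures is measurable. -/
lemma measurable_toJordanDecomposition_posPart {α β : Type*} [m : MeasurableSpace α]
    [MeasurableSpace.CountablyGenerated α]
    [MeasurableSpace β] {z : β → SignedMeasure α}
    (hz : ∀ A, MeasurableSet A → Measurable fun s => z s A) :
    Measurable fun s => (z s).toJordanDecomposition.posPart := by
  refine Measure.measurable_of_measurable_coe _ fun A hA => ?_
  set 𝒜 := generateSetAlgebra (MeasurableSpace.countableGeneratingSet α)
  have hgen : m = MeasurableSpace.generateFrom 𝒜 := by
    rw [generateFrom_generateSetAlgebra_eq, MeasurableSpace.generateFrom_countableGeneratingSet]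
  have hc : 𝒜.Countable :=
    countable_generateSetAlgebra (MeasurableSpace.countable_countableGeneratingSet)
  simp_rw [fun s => posPart_apply_eq_iSup (z s) isSetAlgebra_generateSetAlgebra hgen hA]
  refine Measurable.biSup 𝒜 hc fun B hB => (hz _ (hA.inter ?_)).ennreal_ofReal
  rw [hgen]; exact MeasurableSpace.measurableSet_generateFrom hB

/-- Parametric integrals against a measurable family of finite measures are measurable. -/
lemma measurable_integral_of_measurable_measure {α β : Type*} [MeasurableSpace α]
    [MeasurableSpace β] {μ : β → Measure α} (hμ : Measurable μ)
    (hfin : ∀ s, IsFiniteMeasure (μ s)) {f : β → α → ℝ} (hf : Measurable (Function.uncurry f)) :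
    Measurable fun s => ∫ x, f s x ∂μ s := by
  let c : β → ENNReal := fun s => (1 + μ s univ)⁻¹
  have hc : Measurable c :=
    (measurable_const.add ((Measure.measurable_coe MeasurableSet.univ).comp hμ)).inv
  have hc0 : ∀ s, c s ≠ 0 := fun s => by simp [c]
  have hctop : ∀ s, c s ≠ ⊤ := fun s => by simp [c]
  let κ : Kernel β α := ⟨fun s => c s • μ s, Measure.measurable_of_measurable_coe _ fun A hA => by
    exact hc.mul ((Measure.measurable_coe hA).comp hμ)⟩
  have : IsFiniteKernel κ := ⟨1, by simp, fun s => by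
    change (c s • μ s) univ ≤ 1
    simp only [Measure.smul_apply, smul_eq_mul, c]
    rw [mul_comm, ← div_eq_mul_inv]
    exact ENNReal.div_le_of_le_mul (by simp)⟩
  have h1 : Measurable fun s => ∫ x, f s x ∂κ s :=
    (StronglyMeasurable.integral_kernel_prod_right hf.stronglyMeasurable).measurable
  have h2 : (fun s => ∫ x, f s x ∂μ s) = fun s => (c s).toReal⁻¹ * ∫ x, f s x ∂κ s := by
    ext s
    change _ = (c s).toReal⁻¹ * ∫ x, f s x ∂(c s • μ s)
    rw [integral_smul_measure, smul_eq_mul, inv_mul_cancel_left₀]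
    exact ENNReal.toReal_ne_zero.2 ⟨hc0 s, hctop s⟩
  rw [h2]
  exact hc.ennreal_toReal.inv.mul h1

/-- Parametric integrals against a setwise measurable family of signed measures are
measurable. -/
lemma measurable_sintegral {α β : Type*} [MeasurableSpace α]
    [MeasurableSpace.CountablyGenerated α] [MeasurableSpace β] {z : β → SignedMeasure α}
    (hz : ∀ A, MeasurableSet A → Measurable fun s => z s A) {f : β → α → ℝ}
    (hf : Measurable (Function.uncurry f)) : Measurable fun s => sintegral (z s) (f s) := by
  have hneg : Measurable fun s => (z s).toJordanDecomposition.negPart := by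
    have := measurable_toJordanDecomposition_posPart (z := fun s => -z s) fun A hA => by
      exact (hz A hA).neg
    simpa [SignedMeasure.toJordanDecomposition_neg] using this
  exact (measurable_integral_of_measurable_measure (measurable_toJordanDecomposition_posPart hz)
    (fun _ => inferInstance) hf).sub
    (measurable_integral_of_measurable_measure hneg (fun _ => inferInstance) hf)

/-- Two finite measures whose difference has density `k` integrate the same functions, among
those that are integrable against the density, and the integrals differ by `∫ f k`. -/
lemma integral_sub_integral_of_density {α : Type*} [MeasurableSpace α] {ν μ₁ μ₂ : Measure α}
    [IsFiniteMeasure μ₁] [IsFiniteMeasure μ₂] {k : α → ℝ} (hkm : Measurable k)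
    (hk : Integrable k ν)
    (h : ∀ A, MeasurableSet A → μ₁.real A - μ₂.real A = ∫ x in A, k x ∂ν)
    {f : α → ℝ} (hfk : Integrable (fun x => f x * k x) ν) (hf : Measurable f) :
    (Integrable f μ₁ ↔ Integrable f μ₂) ∧
      (Integrable f μ₁ → ∫ x, f x ∂μ₁ - ∫ x, f x ∂μ₂ = ∫ x, f x * k x ∂ν) := by
  have hdens : ∀ {l : α → ℝ}, Measurable l → Integrable l ν →
      Integrable (fun x => f x * l x) ν → (∀ x, 0 ≤ l x) →
      Integrable f (ν.withDensity fun x => ENNReal.ofReal (l x)) ∧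
      ∫ x, f x ∂(ν.withDensity fun x => ENNReal.ofReal (l x)) = ∫ x, f x * l x ∂ν := by
    intro l hlm hl hfl hl0
    constructor
    · rw [integrable_withDensity_iff_integrable_smul' hlm.ennreal_ofReal (by simp)]
      refine hfl.congr (Eventually.of_forall fun x => ?_)
      simp [ENNReal.toReal_ofReal (hl0 x), mul_comm]
    · rw [integral_withDensity_eq_integral_toReal_smul hlm.ennreal_ofReal (by simp)]
      refine integral_congr_ae (Eventually.of_forall fun x => ?_)
      simp [ENNReal.toReal_ofReal (hl0 x), mul_comm]
  set kp : α → ℝ := fun x => max (k x) 0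
  set kn : α → ℝ := fun x => max (-k x) 0
  have hkk : ∀ x, kp x - kn x = k x := fun x => max_zero_sub_max_neg_zero_eq_self (k x)
  have hbound : ∀ x, |kp x| ≤ |k x| ∧ |kn x| ≤ |k x| := fun x => by
    constructor
    · rw [abs_of_nonneg (le_max_right _ _)]; exact max_le (le_abs_self _) (abs_nonneg _)
    · rw [abs_of_nonneg (le_max_right _ _)]; exact max_le (neg_le_abs _) (abs_nonneg _)
  have hkpm : Measurable kp := hkm.max measurable_const
  have hknm : Measurable kn := hkm.neg.max measurable_const
  have hkp : Integrable kp ν := hk.mono hkpm.aestronglyMeasurable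
    (Eventually.of_forall fun x => (hbound x).1)
  have hkn : Integrable kn ν := hk.mono hknm.aestronglyMeasurable
    (Eventually.of_forall fun x => (hbound x).2)
  have hfkp : Integrable (fun x => f x * kp x) ν :=
    hfk.mono (hf.mul hkpm).aestronglyMeasurable (Eventually.of_forall fun x => by
      simp only [norm_mul, Real.norm_eq_abs]
      exact mul_le_mul_of_nonneg_left (hbound x).1 (abs_nonneg _))
  have hfkn : Integrable (fun x => f x * kn x) ν :=
    hfk.mono (hf.mul hknm).aestronglyMeasurable (Eventually.of_forall fun x => by
      simp only [norm_mul, Real.norm_eq_abs]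
      exact mul_le_mul_of_nonneg_left (hbound x).2 (abs_nonneg _))
  obtain ⟨hp1, hp2⟩ := hdens hkpm hkp hfkp fun x => le_max_right _ _
  obtain ⟨hn1, hn2⟩ := hdens hknm hkn hfkn fun x => le_max_right _ _
  set ρp := ν.withDensity fun x => ENNReal.ofReal (kp x)
  set ρn := ν.withDensity fun x => ENNReal.ofReal (kn x)
  have hfp : IsFiniteMeasure ρp := isFiniteMeasure_withDensity_ofReal hkp.2
  have hfn : IsFiniteMeasure ρn := isFiniteMeasure_withDensity_ofReal hkn.2
  have hreal : ∀ {l : α → ℝ}, Integrable l ν → (∀ x, 0 ≤ l x) → ∀ A, MeasurableSet A →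
      (ν.withDensity fun x => ENNReal.ofReal (l x)).real A = ∫ x in A, l x ∂ν := by
    intro l hl hl0 A hA
    rw [Measure.real, withDensity_apply _ hA, integral_eq_lintegral_of_nonneg_ae
      (Eventually.of_forall hl0) hl.1.restrict]
  have hsum : μ₁ + ρn = μ₂ + ρp := by
    ext A hA
    rw [← ENNReal.toReal_eq_toReal_iff' (measure_ne_top _ _) (measure_ne_top _ _)]
    change (μ₁ + ρn).real A = (μ₂ + ρp).real A
    rw [measureReal_add_apply, measureReal_add_apply, hreal hkn (fun x => le_max_right _ _) A hA,
      hreal hkp (fun x => le_max_right _ _) A hA]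
    have h1 := h A hA
    have h2 : ∫ x in A, k x ∂ν = ∫ x in A, kp x ∂ν - ∫ x in A, kn x ∂ν := by
      rw [← integral_sub hkp.integrableOn hkn.integrableOn]; simp_rw [hkk]
    linarith
  have hiff : Integrable f μ₁ ↔ Integrable f μ₂ := by
    have h1 : Integrable f (μ₁ + ρn) ↔ Integrable f (μ₂ + ρp) := by rw [hsum]
    rw [integrable_add_measure, integrable_add_measure] at h1
    tauto
  refine ⟨hiff, fun h1 => ?_⟩
  have h3 : ∫ x, f x ∂(μ₁ + ρn) = ∫ x, f x ∂(μ₂ + ρp) := by rw [hsum]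
  rw [integral_add_measure h1 hn1, integral_add_measure (hiff.1 h1) hp1, hp2, hn2] at h3
  have h4 : ∫ x, f x * k x ∂ν = ∫ x, f x * kp x ∂ν - ∫ x, f x * kn x ∂ν := by
    rw [← integral_sub hfkp hfkn]; simp_rw [← mul_sub, hkk]
  linarith

/-- Integrals against two finite measures whose difference has density `k` either differ by
`∫ f k`, or are both undefined. -/
lemma integral_sub_integral_mem_of_density {α : Type*} [MeasurableSpace α] {ν μ₁ μ₂ : Measure α}
    [IsFiniteMeasure μ₁] [IsFiniteMeasure μ₂] {k : α → ℝ} (hkm : Measurable k)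
    (hk : Integrable k ν)
    (h : ∀ A, MeasurableSet A → μ₁.real A - μ₂.real A = ∫ x in A, k x ∂ν)
    {f : α → ℝ} (hfk : Integrable (fun x => f x * k x) ν) (hf : Measurable f) :
    ∫ x, f x ∂μ₁ - ∫ x, f x ∂μ₂ = 0 ∨
      ∫ x, f x ∂μ₁ - ∫ x, f x ∂μ₂ = ∫ x, f x * k x ∂ν := by
  obtain ⟨h1, h2⟩ := integral_sub_integral_of_density hkm hk h hfk hf
  by_cases hi : Integrable f μ₁
  · exact Or.inr (h2 hi)
  · rw [integral_undef hi, integral_undef (fun h => hi (h1.2 h))]; simp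

/-- If the difference of two signed measures has density `g`, then the differences of their
positive and negative parts have densities `h` and `h - g`, where `h` lies between `0` and `g`. -/
lemma exists_density_posPart_sub {α : Type*} [MeasurableSpace α] {ν : Measure α} [SigmaFinite ν]
    {z₁ z₂ : SignedMeasure α} {g : α → ℝ} (hg : Integrable g ν)
    (h : ∀ A, MeasurableSet A → (z₁ - z₂) A = ∫ x in A, g x ∂ν) :
    ∃ k : α → ℝ, Measurable k ∧ Integrable k ν ∧ (∀ᵐ x ∂ν, min (g x) 0 ≤ k x ∧ k x ≤ max (g x) 0) ∧
      (∀ A, MeasurableSet A → z₁.toJordanDecomposition.posPart.real A -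
        z₂.toJordanDecomposition.posPart.real A = ∫ x in A, k x ∂ν) ∧
      (∀ A, MeasurableSet A → z₁.toJordanDecomposition.negPart.real A -
        z₂.toJordanDecomposition.negPart.real A = ∫ x in A, (k x - g x) ∂ν) := by
  have hle : ∀ {w₁ w₂ : SignedMeasure α} {b : α → ℝ}, Integrable b ν →
      (∀ A, MeasurableSet A → (w₁ - w₂) A = ∫ x in A, b x ∂ν) → ∀ A, MeasurableSet A →
      w₁.toJordanDecomposition.posPart.real A - w₂.toJordanDecomposition.posPart.real A ≤
        ∫ x in A, max (b x) 0 ∂ν := by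
    intro w₁ w₂ b hb hw A hA
    obtain ⟨S, hS, hpS, hnS⟩ := w₁.toJordanDecomposition.mutuallySingular
    set p₁ := w₁.toJordanDecomposition.posPart
    set n₁ := w₁.toJordanDecomposition.negPart
    set p₂ := w₂.toJordanDecomposition.posPart
    set n₂ := w₂.toJordanDecomposition.negPart
    have hAS := hA.inter hS.compl
    have h1 : p₁.real A = w₁ (A ∩ Sᶜ) := by
      rw [signedMeasure_apply_eq_real_sub _ hAS]
      have e1 : n₁.real (A ∩ Sᶜ) = 0 := by
        rw [Measure.real, measure_mono_null inter_subset_right hnS]; rfl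
      have e2 : p₁.real (A ∩ Sᶜ) = p₁.real A := by
        rw [← sdiff_eq, Measure.real, measure_sdiff_null hpS]; rfl
      change _ = p₁.real _ - n₁.real _
      rw [e1, e2, sub_zero]
    have h2 : w₂ (A ∩ Sᶜ) ≤ p₂.real A := by
      rw [signedMeasure_apply_eq_real_sub _ hAS]
      have e1 : 0 ≤ n₂.real (A ∩ Sᶜ) := measureReal_nonneg
      have e2 : p₂.real (A ∩ Sᶜ) ≤ p₂.real A := measureReal_mono inter_subset_left
      change p₂.real _ - n₂.real _ ≤ _
      linarith
    have h3 : ∫ x in A ∩ Sᶜ, b x ∂ν ≤ ∫ x in A, max (b x) 0 ∂ν := by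
      calc _ ≤ ∫ x in A ∩ Sᶜ, max (b x) 0 ∂ν :=
            setIntegral_mono hb.integrableOn hb.pos_part.integrableOn fun x => le_max_left _ _
        _ ≤ _ := setIntegral_mono_set hb.pos_part.integrableOn
            (Eventually.of_forall fun x => le_max_right _ _)
            (Eventually.of_forall inter_subset_left)
    have h4 := hw _ hAS
    rw [sub_apply] at h4
    linarith
  set p₁ := z₁.toJordanDecomposition.posPart
  set p₂ := z₂.toJordanDecomposition.posPart
  have hup := hle hg h
  have hlow := hle (w₁ := z₂) (w₂ := z₁) hg.neg fun A hA => by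
    have := h A hA
    rw [sub_apply] at this ⊢
    simp only [Pi.neg_apply, integral_neg]
    linarith
  simp only [Pi.neg_apply] at hlow
  set v : SignedMeasure α := p₁.toSignedMeasure - p₂.toSignedMeasure
  have hv : ∀ A, MeasurableSet A → v A = p₁.real A - p₂.real A :=
    fun A hA => Measure.toSignedMeasure_sub_apply hA
  have hac : v ≪ᵥ ν.toENNRealVectorMeasure := by
    refine VectorMeasure.AbsolutelyContinuous.mk fun A hA h0 => ?_
    rw [Measure.toENNRealVectorMeasure_apply_measurable hA] at h0
    have e1 := hup A hA
    have e2 := hlow A hA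
    rw [setIntegral_measure_zero _ h0] at e1 e2
    rw [hv A hA]; linarith
  have hrn := SignedMeasure.withDensityᵥ_rnDeriv_eq v ν hac
  set k := v.rnDeriv ν
  have hkm : Measurable k := SignedMeasure.measurable_rnDeriv _ _
  have hk : Integrable k ν := SignedMeasure.integrable_rnDeriv _ _
  have hkA : ∀ A, MeasurableSet A → p₁.real A - p₂.real A = ∫ x in A, k x ∂ν := by
    intro A hA
    rw [← hv A hA, ← hrn, withDensityᵥ_apply hk hA]
  refine ⟨k, hkm, hk, ?_, hkA, fun A hA => ?_⟩
  · have hu : k ≤ᵐ[ν] fun x => max (g x) 0 :=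
      ae_le_of_forall_setIntegral_le hk hg.pos_part fun A hA _ =>
        (hkA A hA).symm.trans_le (hup A hA)
    have hl : (fun x => -k x) ≤ᵐ[ν] fun x => max (-g x) 0 :=
      ae_le_of_forall_setIntegral_le hk.neg hg.neg.pos_part fun A hA _ => by
        rw [integral_neg, ← hkA A hA]
        have := hlow A hA
        linarith
    filter_upwards [hu, hl] with x h1 h2
    refine ⟨?_, h1⟩
    have : max (-g x) 0 = - min (g x) 0 := by rw [← neg_zero, max_neg_neg]; simp
    linarith
  · rw [integral_sub hk.integrableOn hg.integrableOn, ← hkA A hA, ← h A hA,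
      sub_apply, signedMeasure_apply_eq_real_sub z₁ hA,
      signedMeasure_apply_eq_real_sub z₂ hA]
    ring

/-- The difference of the integrals of `f` against two signed measures whose difference has
density `g` is the integral of `f` against one of four functions lying between `0` and `g`;
which one it is depends on which of the integrals are defined. -/
lemma exists_sintegral_sub_mem {α : Type*} [MeasurableSpace α] {ν : Measure α} [SigmaFinite ν]
    {z₁ z₂ : SignedMeasure α} {g : α → ℝ} (hgm : Measurable g) (hg : Integrable g ν)
    (h : ∀ A, MeasurableSet A → (z₁ - z₂) A = ∫ x in A, g x ∂ν) :
    ∃ k : α → ℝ, Measurable k ∧ (∀ᵐ x ∂ν, min (g x) 0 ≤ k x ∧ k x ≤ max (g x) 0) ∧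
      (∀ f : α → ℝ, Measurable f → Integrable (fun x => f x * g x) ν →
        sintegral z₁ f - sintegral z₂ f = 0 ∨
        sintegral z₁ f - sintegral z₂ f = ∫ x, f x * k x ∂ν ∨
        sintegral z₁ f - sintegral z₂ f = ∫ x, f x * (g x - k x) ∂ν ∨
        sintegral z₁ f - sintegral z₂ f = ∫ x, f x * g x ∂ν) ∧
      (∀ f : α → ℝ, Measurable f → (∃ C, ∀ x, ‖f x‖ ≤ C) →
        sintegral z₁ f - sintegral z₂ f = ∫ x, f x * g x ∂ν) := by
  obtain ⟨k, hkm, hk, hkb, hp, hn⟩ := exists_density_posPart_sub hg h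
  have hbd : ∀ᵐ x ∂ν, |k x| ≤ |g x| := by
    filter_upwards [hkb] with x hx
    have h1 : max (g x) 0 ≤ |g x| := max_le (le_abs_self _) (abs_nonneg _)
    have h2 : -|g x| ≤ min (g x) 0 := le_min (neg_abs_le _) (by simp)
    exact abs_le.2 ⟨h2.trans hx.1, hx.2.trans h1⟩
  have hfk : ∀ f : α → ℝ, Measurable f → Integrable (fun x => f x * g x) ν →
      Integrable (fun x => f x * k x) ν := fun f hf hfg =>
    hfg.mono (hf.mul hkm).aestronglyMeasurable (by
      filter_upwards [hbd] with x hx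
      simp only [norm_mul, Real.norm_eq_abs]
      exact mul_le_mul_of_nonneg_left hx (abs_nonneg _))
  have hfkg : ∀ f : α → ℝ, Measurable f → Integrable (fun x => f x * g x) ν →
      Integrable (fun x => f x * (k x - g x)) ν := fun f hf hfg =>
    ((hfk f hf hfg).sub hfg).congr (Eventually.of_forall fun x => by simp [mul_sub])
  have hsplit : ∀ f : α → ℝ, Measurable f → Integrable (fun x => f x * g x) ν →
      ∫ x, f x * g x ∂ν = ∫ x, f x * k x ∂ν - ∫ x, f x * (k x - g x) ∂ν := fun f hf hfg => by
    rw [← integral_sub (hfk f hf hfg) (hfkg f hf hfg)]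
    congr 1; ext x; ring
  have hneg : ∀ f : α → ℝ, ∫ x, f x * (g x - k x) ∂ν = - ∫ x, f x * (k x - g x) ∂ν := fun f => by
    rw [← integral_neg]; congr 1; ext x; ring
  refine ⟨k, hkm, hkb, fun f hf hfg => ?_, fun f hf hfb => ?_⟩
  · have h1 := integral_sub_integral_mem_of_density hkm hk hp (hfk f hf hfg) hf
    have h2 := integral_sub_integral_mem_of_density (hkm.sub hgm) (hk.sub hg) hn
      (hfkg f hf hfg) hf
    simp only [Pi.sub_apply] at h2
    rw [hsplit f hf hfg, hneg]
    unfold sintegral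
    rcases h1 with h1 | h1 <;> rcases h2 with h2 | h2
    · left; linarith
    · right; right; left; linarith
    · right; left; linarith
    · right; right; right; linarith
  · obtain ⟨C, hC⟩ := hfb
    have hi : ∀ μ : Measure α, IsFiniteMeasure μ → Integrable f μ := fun μ _ =>
      Integrable.of_bound hf.aestronglyMeasurable C (Eventually.of_forall hC)
    have hfg : Integrable (fun x => f x * g x) ν :=
      hg.bdd_mul hf.aestronglyMeasurable (Eventually.of_forall hC)
    have h1 := (integral_sub_integral_of_density hkm hk hp (hfk f hf hfg) hf).2
      (hi _ inferInstance)
    have h2 := (integral_sub_integral_of_density (hkm.sub hgm) (hk.sub hg) hn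
      (hfkg f hf hfg) hf).2 (hi _ inferInstance)
    simp only [Pi.sub_apply] at h2
    rw [hsplit f hf hfg]
    unfold sintegral
    linarith

/-- A locally integrable density of a finite signed measure is integrable. -/
lemma integrable_of_signedMeasure_apply_eq {E : Type*} [PseudoMetricSpace E] [ProperSpace E]
    [MeasurableSpace E] [OpensMeasurableSpace E] {ν : Measure E}
    {z : SignedMeasure E} {g : E → ℝ} (hgm : Measurable g) (hg : LocallyIntegrable g ν)
    (h : ∀ A, MeasurableSet A → z A = ∫ x in A, g x ∂ν) : Integrable g ν := by
  rcases isEmpty_or_nonempty E with hE | ⟨⟨x₀⟩⟩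
  · exact (integrable_zero E ℝ ν).congr (Eventually.of_forall fun x => (hE.false x).elim)
  have h_int : ∀ n : ℕ, IntegrableOn g (Metric.closedBall x₀ n) ν := fun n =>
    hg.integrableOn_isCompact (isCompact_closedBall _ _)
  have hb : ∀ A, MeasurableSet A → |z A| ≤ z.toJordanDecomposition.posPart.real univ +
      z.toJordanDecomposition.negPart.real univ := fun A hA => by
    rw [signedMeasure_apply_eq_real_sub z hA]
    have h1 : z.toJordanDecomposition.posPart.real A ≤ _ := measureReal_mono (subset_univ A)
    have h2 : z.toJordanDecomposition.negPart.real A ≤ _ := measureReal_mono (subset_univ A)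
    have h3 : 0 ≤ z.toJordanDecomposition.posPart.real A := measureReal_nonneg
    have h4 : 0 ≤ z.toJordanDecomposition.negPart.real A := measureReal_nonneg
    rw [abs_le]; constructor <;> linarith
  set C := z.toJordanDecomposition.posPart.real univ + z.toJordanDecomposition.negPart.real univ
  refine (aecover_closedBall (x := x₀) tendsto_natCast_atTop_atTop).integrable_of_integral_norm_bounded
    (2 * C) h_int (Eventually.of_forall fun n => ?_)
  have hS : MeasurableSet {x | 0 ≤ g x} := measurableSet_le measurable_const hgm
  have hB : MeasurableSet (Metric.closedBall x₀ (n : ℝ)) := measurableSet_closedBall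
  rw [← integral_add_compl₀ (s := {x | 0 ≤ g x}) (μ := ν.restrict _) hS.nullMeasurableSet
    (h_int n).norm, Measure.restrict_restrict hS, Measure.restrict_restrict hS.compl,
    setIntegral_congr_fun (f := fun x => ‖g x‖) (g := g) (hS.inter hB) fun x hx =>
      Real.norm_of_nonneg hx.1,
    setIntegral_congr_fun (f := fun x => ‖g x‖) (g := fun x => - g x) (hS.compl.inter hB)
      fun x hx =>
      Real.norm_of_nonpos (le_of_not_ge hx.1), integral_neg, ← h _ (hS.inter hB),
    ← h _ (hS.compl.inter hB)]
  have h1 := (abs_le.1 (hb _ (hS.inter hB))).2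
  have h2 := (abs_le.1 (hb _ (hS.compl.inter hB))).1
  linarith

/-- If `D t` is the difference of the primitives of `F₁` and `F₂`, and the two primitives may be
undefined, then `D` is still the primitive of a function which is pointwise `0` or `F₁ - F₂`. -/
lemma exists_primitive_of_eq_sub {T : ℝ} (hT : 0 < T) {F₁ F₂ D : ℝ → ℝ}
    (hJ : IntegrableOn (fun s => F₁ s - F₂ s) (Ioc 0 T)) (hD : ContinuousOn D (Icc 0 T))
    (h : ∀ t ∈ Icc 0 T, D t = (∫ s in (0 : ℝ)..t, F₁ s) - ∫ s in (0 : ℝ)..t, F₂ s) :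
    ∃ J : ℝ → ℝ, IntegrableOn J (Ioc 0 T) ∧ (∀ s, J s = 0 ∨ J s = F₁ s - F₂ s) ∧
      ∀ t ∈ Icc 0 T, D t = ∫ s in (0 : ℝ)..t, J s := by
  set J : ℝ → ℝ := fun s => F₁ s - F₂ s
  have hJt : ∀ t ∈ Icc 0 T, IntervalIntegrable J volume 0 t := fun t ht =>
    (intervalIntegrable_iff_integrableOn_Ioc_of_le ht.1).2
      (hJ.mono_set (Ioc_subset_Ioc_right ht.2))
  have hdef : ∀ t ∈ Icc 0 T, IntervalIntegrable F₁ volume 0 t → D t = ∫ s in (0 : ℝ)..t, J s := by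
    intro t ht h1
    have h2 : IntervalIntegrable F₂ volume 0 t :=
      (h1.sub (hJt t ht)).congr fun x _ => by simp [J]
    rw [h t ht, intervalIntegral.integral_sub h1 h2]
  have hundef : ∀ t ∈ Icc 0 T, ¬ IntervalIntegrable F₁ volume 0 t → D t = 0 := by
    intro t ht h1
    have h2 : ¬ IntervalIntegrable F₂ volume 0 t := fun h2 => h1 <|
      (h2.add (hJt t ht)).congr fun x _ => by simp [J]
    rw [h t ht, intervalIntegral.integral_undef h1, intervalIntegral.integral_undef h2, sub_zero]
  by_cases hPT : IntervalIntegrable F₁ volume 0 T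
  · exact ⟨J, hJ, fun s => Or.inr rfl, fun t ht => hdef t ht <|
      hPT.mono_set (by rw [uIcc_of_le ht.1, uIcc_of_le hT.le]; exact Icc_subset_Icc_right ht.2)⟩
  set S : Set ℝ := {t | t ∈ Icc 0 T ∧ IntervalIntegrable F₁ volume 0 t}
  have h0S : (0 : ℝ) ∈ S := ⟨⟨le_rfl, hT.le⟩, by simp⟩
  have hSb : BddAbove S := ⟨T, fun t ht => ht.1.2⟩
  set τ := sSup S
  have hτ0 : 0 ≤ τ := le_csSup hSb h0S
  have hτT : τ ≤ T := csSup_le ⟨0, h0S⟩ fun t ht => ht.1.2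
  have hτ : τ ∈ Icc 0 T := ⟨hτ0, hτT⟩
  have hlow : ∀ t, 0 ≤ t → t < τ → D t = ∫ s in (0 : ℝ)..t, J s := by
    intro t ht htτ
    obtain ⟨r, hr, htr⟩ := exists_lt_of_lt_csSup ⟨0, h0S⟩ htτ
    refine hdef t ⟨ht, (htτ.le.trans hτT)⟩ (hr.2.mono_set ?_)
    rw [uIcc_of_le ht, uIcc_of_le (ht.trans htr.le)]
    exact Icc_subset_Icc_right htr.le
  have hhigh : ∀ t ∈ Icc 0 T, τ < t → D t = 0 := fun t ht htτ =>
    hundef t ht fun h1 => absurd (le_csSup hSb ⟨ht, h1⟩) (not_le.2 htτ)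
  have hprim : ContinuousOn (fun t => ∫ s in (0 : ℝ)..t, J s) (Icc 0 T) := by
    have := intervalIntegral.continuousOn_primitive_interval (f := J) (μ := volume) (a := 0)
      (b := T) (by rw [uIcc_of_le hT.le]; exact (integrableOn_Icc_iff_integrableOn_Ioc).2 hJ)
    rwa [uIcc_of_le hT.le] at this
  have hDτ : D τ = ∫ s in (0 : ℝ)..τ, J s := by
    rcases hτ0.eq_or_lt with h0 | h0
    · rw [← h0, h 0 ⟨le_rfl, hT.le⟩]; simp
    have hcl : τ ∈ closure (Ico 0 τ) := by
      rw [closure_Ico h0.ne]; exact ⟨hτ0, le_rfl⟩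
    have hsub : Ico 0 τ ⊆ Icc 0 T := fun x hx => ⟨hx.1, hx.2.le.trans hτT⟩
    have : (𝓝[Ico 0 τ] τ).NeBot := mem_closure_iff_nhdsWithin_neBot.1 hcl
    refine tendsto_nhds_unique ((hD τ hτ).mono_left (nhdsWithin_mono _ hsub)) ?_
    refine ((hprim τ hτ).mono_left (nhdsWithin_mono _ hsub)).congr' ?_
    filter_upwards [self_mem_nhdsWithin] with t ht using (hlow t ht.1 ht.2).symm
  have hDτ0 : D τ = 0 := by
    rcases hτT.eq_or_lt with h0 | h0
    · exact hundef τ hτ (h0 ▸ hPT)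
    have hcl : τ ∈ closure (Ioc τ T) := by
      rw [closure_Ioc h0.ne]; exact ⟨le_rfl, hτT⟩
    have hsub : Ioc τ T ⊆ Icc 0 T := fun x hx => ⟨hτ0.trans hx.1.le, hx.2⟩
    have : (𝓝[Ioc τ T] τ).NeBot := mem_closure_iff_nhdsWithin_neBot.1 hcl
    refine tendsto_nhds_unique ((hD τ hτ).mono_left (nhdsWithin_mono _ hsub)) ?_
    refine tendsto_const_nhds.congr' ?_
    filter_upwards [self_mem_nhdsWithin] with t ht using (hhigh t (hsub ht) ht.1).symm
  refine ⟨(Iic τ).indicator J, hJ.indicator measurableSet_Iic, fun s => ?_, fun t ht => ?_⟩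
  · by_cases hs : s ∈ Iic τ
    · right; simp [hs, J]
    · left; simp [hs]
  · rw [intervalIntegral.integral_of_le ht.1, setIntegral_indicator measurableSet_Iic,
      Ioc_inter_Iic, ← intervalIntegral.integral_of_le (le_inf ht.1 hτ0)]
    rcases lt_trichotomy t τ with h1 | h1 | h1
    · rw [inf_eq_left.2 h1.le]; exact hlow t ht.1 h1
    · rw [h1, inf_idem]; exact hDτ
    · rw [inf_eq_right.2 h1.le, ← hDτ, hDτ0]; exact hhigh t ht h1

/-- A function on an interval with vanishing primitive vanishes almost everywhere. -/
lemma ae_eq_zero_of_primitive_eq_zero {T : ℝ} (hT : 0 < T) {J : ℝ → ℝ}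
    (hJ : IntegrableOn J (Ioc 0 T)) (h : ∀ t ∈ Icc 0 T, ∫ s in (0 : ℝ)..t, J s = 0) :
    ∀ᵐ s ∂volume.restrict (Ioc 0 T), J s = 0 := by
  have hi : IntervalIntegrable J volume 0 T :=
    (intervalIntegrable_iff_integrableOn_Ioc_of_le hT.le).2 hJ
  rw [← restrict_Ioo_eq_restrict_Ioc, ae_restrict_iff' measurableSet_Ioo]
  filter_upwards [hi.ae_hasDerivAt_integral] with s hs hsm
  rw [uIcc_of_le hT.le] at hs
  have h1 := hs (Ioo_subset_Icc_self hsm) 0 ⟨le_rfl, hT.le⟩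
  refine h1.unique ((hasDerivAt_const s (0 : ℝ)).congr_of_eventuallyEq ?_)
  filter_upwards [Icc_mem_nhds hsm.1 hsm.2] with t ht using h t ht

/-- A linear functional whose value at every point agrees with one of finitely many linear
functionals is one of them. -/
lemma exists_linearMap_eq_of_forall_exists_eq {k V W ι : Type*} [Field k] [Infinite k]
    [AddCommGroup V] [Module k V] [AddCommGroup W] [Module k W] [Finite ι]
    (J : V →ₗ[k] W) (L : ι → V →ₗ[k] W) (h : ∀ x, ∃ i, J x = L i x) : ∃ i, J = L i := by
  obtain ⟨i, hi⟩ := Subspace.exists_eq_top_of_iUnion_eq_univ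
    (p := fun i => LinearMap.ker (J - L i)) (by
      ext x
      simpa [sub_eq_zero] using h x)
  exact ⟨i, sub_eq_zero.1 (LinearMap.ker_eq_top.1 hi)⟩

/-- A map from a real vector space to a separable metric space is approximated by its restriction
to a countable rational subspace. -/
lemma exists_rat_addMonoidHom_dense {V W : Type*} [AddCommGroup V] [Module ℝ V]
    [PseudoMetricSpace W] [SecondCountableTopology W] (P : V → W) :
    ∃ q : (ℕ →₀ ℚ) →+ V, ∀ v, P v ∈ closure (range (P ∘ q)) := by
  have : Nonempty (range P) := ⟨⟨P 0, 0, rfl⟩⟩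
  choose φ hφ using fun n => (TopologicalSpace.denseSeq (range P) n).2
  let q : (ℕ →₀ ℚ) →+ V :=
    { toFun := fun x => x.sum fun i r => (r : ℝ) • φ i
      map_zero' := by simp
      map_add' := fun x y => Finsupp.sum_add_index' (by simp) (by simp [add_smul]) }
  refine ⟨q, fun v => ?_⟩
  have hd := (TopologicalSpace.denseRange_denseSeq (range P)) ⟨P v, v, rfl⟩
  have h1 := image_closure_subset_closure_image continuous_subtype_val (mem_image_of_mem _ hd)
  refine closure_mono ?_ h1
  rintro _ ⟨_, ⟨n, rfl⟩, rfl⟩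
  have hq : q (Finsupp.single n 1) = φ n :=
    (Finsupp.sum_single_index (h := fun i (r : ℚ) => (r : ℝ) • φ i) (by simp)).trans (by simp)
  exact ⟨Finsupp.single n 1, by rw [Function.comp_apply, hq, hφ]⟩

/-- The squared norm of the primitive of an integrable function is the primitive of twice the
inner product of the function with its primitive. -/
lemma norm_sq_intervalIntegral_eq {K : Type*} [NormedAddCommGroup K] [InnerProductSpace ℝ K]
    [CompleteSpace K] {t : ℝ} (ht : 0 ≤ t) {X : ℝ → K} (hX : IntervalIntegrable X volume 0 t) :
    ‖∫ s in (0 : ℝ)..t, X s‖ ^ 2 =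
      ∫ s in (0 : ℝ)..t, 2 * inner ℝ (∫ r in (0 : ℝ)..s, X r) (X s) := by
  set Y : ℝ → K := fun s => ∫ r in (0 : ℝ)..s, X r
  set h : ℝ → ℝ := fun s => ∫ r in (0 : ℝ)..s, ‖X r‖
  have hsub : ∀ x ∈ Icc 0 t, ∀ y ∈ Icc 0 t, IntervalIntegrable X volume x y := by
    intro x hx y hy
    refine hX.mono_set ?_
    rw [uIcc_of_le ht]
    exact uIcc_subset_Icc hx hy
  have h0 : (0 : ℝ) ∈ Icc 0 t := ⟨le_rfl, ht⟩
  have hYd : ∀ x ∈ Icc 0 t, ∀ y ∈ Icc 0 t, x ≤ y → ‖Y y - Y x‖ ≤ |h y - h x| := by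
    intro x hx y hy hxy
    rw [intervalIntegral.integral_interval_sub_left (hsub 0 h0 y hy) (hsub 0 h0 x hx),
      intervalIntegral.integral_interval_sub_left (hsub 0 h0 y hy).norm (hsub 0 h0 x hx).norm]
    exact (intervalIntegral.norm_integral_le_integral_norm hxy).trans (le_abs_self _)
  have hYdist : ∀ x ∈ Icc 0 t, ∀ y ∈ Icc 0 t, ‖Y x - Y y‖ ≤ dist (h x) (h y) := by
    intro x hx y hy
    rw [Real.dist_eq]
    rcases le_total x y with hxy | hxy
    · rw [norm_sub_rev, abs_sub_comm]; exact hYd x hx y hy hxy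
    · exact hYd y hy x hx hxy
  have hac : AbsolutelyContinuousOnInterval h 0 t :=
    hX.norm.absolutelyContinuousOnInterval_intervalIntegral left_mem_uIcc
  obtain ⟨C, hC⟩ := hac.exists_bound
  rw [uIcc_of_le ht] at hC
  have hh0 : h 0 = 0 := by simp [h]
  have hY0 : Y 0 = 0 := by simp [Y]
  have hYC : ∀ x ∈ Icc 0 t, ‖Y x‖ ≤ C := fun x hx => by
    have h1 := hYdist x hx 0 h0
    rw [hY0, hh0, sub_zero, dist_zero_right] at h1
    exact h1.trans (hC x hx)
  have heac : AbsolutelyContinuousOnInterval (fun s => ‖Y s‖ ^ 2) 0 t := by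
    have hlim := Tendsto.const_mul (2 * C) hac
    rw [mul_zero] at hlim
    refine squeeze_zero' (Eventually.of_forall fun E => Finset.sum_nonneg fun i _ => dist_nonneg)
      ?_ hlim
    filter_upwards [mem_inf_of_right (mem_principal_self _)] with E hE
    rw [Finset.mul_sum]
    refine Finset.sum_le_sum fun i hi => ?_
    obtain ⟨h1, h2⟩ := hE.1 i hi
    rw [uIcc_of_le ht] at h1 h2
    rw [Real.dist_eq, sq_sub_sq, abs_mul]
    have h3 := hYC _ h1
    have h4 := hYC _ h2
    refine mul_le_mul ?_ ((abs_norm_sub_norm_le _ _).trans (hYdist _ h1 _ h2)) (abs_nonneg _) ?_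
    · rw [abs_of_nonneg (by positivity)]; linarith
    · linarith [norm_nonneg (Y (E.2 i).1)]
  have h1 := heac.integral_deriv_eq_sub
  rw [hY0, norm_zero, zero_pow two_ne_zero, sub_zero] at h1
  rw [← h1]
  refine intervalIntegral.integral_congr_ae ?_
  filter_upwards [hX.ae_hasDerivAt_integral] with s hs hsm
  exact (hs (uIoc_subset_uIcc hsm) 0 left_mem_uIcc).norm_sq.deriv

/-- Energy estimate: if `N n → 1` strongly and `N n G = - M n ^ 2 V`, where `V` is the primitive of
`U` and `⟪U, G⟫ ≥ 0`, then `G = 0`. -/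
lemma ae_eq_zero_of_energy {K : Type*} [NormedAddCommGroup K] [InnerProductSpace ℝ K]
    [CompleteSpace K] {T : ℝ} {U G : ℝ → K}
    (hU : MemLp U 2 (volume.restrict (Ioc 0 T))) (hG : MemLp G 2 (volume.restrict (Ioc 0 T)))
    (hUG : ∀ᵐ s ∂volume.restrict (Ioc 0 T), 0 ≤ inner ℝ (U s) (G s))
    {M N : ℕ → K →L[ℝ] K} (hM : ∀ n x y, inner ℝ (M n x) y = inner ℝ x (M n y))
    (hMle : ∀ m n, m ≤ n → ∀ x, ‖M m x‖ ≤ ‖M n x‖)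
    (hN : ∀ x, Tendsto (fun n => N n x) atTop (𝓝 x)) (hNle : ∀ n x, ‖N n x‖ ≤ ‖x‖)
    (hGV : ∀ᵐ t ∂volume.restrict (Ioc 0 T), ∀ n,
      N n (G t) = -M n (M n (∫ s in (0 : ℝ)..t, U s))) :
    ∀ᵐ s ∂volume.restrict (Ioc 0 T), G s = 0 := by
  set V : ℝ → K := fun t => ∫ s in (0 : ℝ)..t, U s
  have hUi : IntegrableOn U (Ioc 0 T) := hU.integrable (by norm_num)
  have hUt : ∀ t ∈ Icc 0 T, IntervalIntegrable U volume 0 t := fun t ht =>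
    (intervalIntegrable_iff_integrableOn_Ioc_of_le ht.1).2
      (hUi.mono_set (Ioc_subset_Ioc_right ht.2))
  have hMV : ∀ n, ∀ t ∈ Icc 0 T, M n (V t) = ∫ s in (0 : ℝ)..t, M n (U s) := fun n t ht =>
    ((M n).intervalIntegral_comp_comm (hUt t ht)).symm
  have key : ∀ t ∈ Icc 0 T, ∀ m, M m (V t) = 0 := by
    intro t ht m
    have hres : volume.restrict (Ioc 0 t) ≤ volume.restrict (Ioc 0 T) :=
      Measure.restrict_mono (Ioc_subset_Ioc_right ht.2) le_rfl
    have hen : ∀ n, ‖M n (V t)‖ ^ 2 = ∫ s in Ioc 0 t, -2 * inner ℝ (N n (G s)) (U s) := by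
      intro n
      have hi : IntervalIntegrable (fun s => M n (U s)) volume 0 t :=
        (intervalIntegrable_iff_integrableOn_Ioc_of_le ht.1).2
          ((M n).integrable_comp ((intervalIntegrable_iff_integrableOn_Ioc_of_le ht.1).1 (hUt t ht)))
      rw [hMV n t ht, norm_sq_intervalIntegral_eq ht.1 hi, intervalIntegral.integral_of_le ht.1]
      refine integral_congr_ae ?_
      filter_upwards [ae_mono hres hGV, ae_restrict_mem measurableSet_Ioc] with s hs hsm
      rw [hs n, inner_neg_left, hM, hMV n s ⟨hsm.1.le, hsm.2.trans ht.2⟩]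
      ring
    have hGUi : Integrable (fun s => 2 * (‖G s‖ * ‖U s‖)) (volume.restrict (Ioc 0 t)) :=
      ((hG.norm.integrable_mul hU.norm).const_mul 2).mono_measure hres
    have hlim : Tendsto (fun n => ‖M n (V t)‖ ^ 2) atTop
        (𝓝 (∫ s in Ioc 0 t, -2 * inner ℝ (G s) (U s))) := by
      simp_rw [hen]
      refine tendsto_integral_of_dominated_convergence (fun s => 2 * (‖G s‖ * ‖U s‖))
        (fun n => ?_) hGUi (fun n => ?_) ?_
      · exact ((((N n).continuous.comp_aestronglyMeasurable hG.1).inner hU.1).const_mul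
          (-2)).mono_measure hres
      · refine Eventually.of_forall fun s => ?_
        rw [norm_mul, norm_neg, Real.norm_two]
        refine mul_le_mul_of_nonneg_left ?_ two_pos.le
        exact (norm_inner_le_norm _ _).trans
          (mul_le_mul_of_nonneg_right (hNle n _) (norm_nonneg _))
      · exact Eventually.of_forall fun s => ((hN (G s)).inner tendsto_const_nhds).const_mul _
    have hneg : ∫ s in Ioc 0 t, -2 * inner ℝ (G s) (U s) ≤ 0 := by
      refine integral_nonpos_of_ae ?_
      filter_upwards [ae_mono hres hUG] with s hs
      rw [real_inner_comm] at hs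
      simp only [Pi.zero_apply]
      linarith
    have h1 : ‖M m (V t)‖ ^ 2 ≤ 0 := (ge_of_tendsto hlim (by
      filter_upwards [eventually_ge_atTop m] with n hn
      exact pow_le_pow_left₀ (norm_nonneg _) (hMle m n hn _) 2)).trans hneg
    exact norm_eq_zero.1 (pow_eq_zero_iff two_ne_zero |>.1 (le_antisymm h1 (by positivity)))
  filter_upwards [hGV, ae_restrict_mem measurableSet_Ioc] with s hs hsm
  have h2 : ∀ n, N n (G s) = 0 := fun n => by
    rw [hs n, show M n (∫ r in (0 : ℝ)..s, U r) = 0 from key s ⟨hsm.1.le, hsm.2⟩ n, map_zero,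
      neg_zero]
  exact tendsto_nhds_unique (hN (G s)) (by simp [h2])

open scoped SchwartzMap FourierTransform Laplacian LineDeriv

/-- If `w = Δ v` in the sense of tempered distributions, for square integrable `v` and `w`, then
the Fourier transforms satisfy `𝓕 w = - (2 π |ξ|) ^ 2 𝓕 v`. -/
lemma fourier_ae_eq_of_laplacian_eq {E : Type*} [NormedAddCommGroup E] [InnerProductSpace ℝ E]
    [FiniteDimensional ℝ E] [MeasurableSpace E] [BorelSpace E] {v w : Lp ℂ 2 (volume : Measure E)}
    (h : ∀ φ : 𝓢(E, ℂ), ∫ x, φ x • w x = ∫ x, Δ φ x • v x) :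
    ((𝓕 w : Lp ℂ 2 volume) : E → ℂ) =ᵐ[volume]
      fun ξ => (-(2 * Real.pi * ‖ξ‖) ^ 2 : ℝ) • (𝓕 v : Lp ℂ 2 volume) ξ := by
  have h1 : (w : 𝓢'(E, ℂ)) = Δ (v : 𝓢'(E, ℂ)) := by
    ext φ
    rw [TemperedDistribution.laplacian_apply_apply, Lp.toTemperedDistribution_apply,
      Lp.toTemperedDistribution_apply, h φ]
  have h2 : ((𝓕 w : Lp ℂ 2 volume) : 𝓢'(E, ℂ)) = -(2 * Real.pi) ^ 2 •
      TemperedDistribution.smulLeftCLM ℂ (fun x : E => Complex.ofReal (‖x‖ ^ 2))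
        ((𝓕 v : Lp ℂ 2 volume) : 𝓢'(E, ℂ)) := by
    rw [← Lp.fourier_toTemperedDistribution_eq, ← Lp.fourier_toTemperedDistribution_eq, h1,
      TemperedDistribution.laplacian_eq_fourierMultiplierCLM]
    ext φ
    simp [TemperedDistribution.fourierMultiplierCLM_apply]
  have hloc : ∀ u : Lp ℂ 2 (volume : Measure E), LocallyIntegrable u volume := fun u =>
    (Lp.memLp u).locallyIntegrable (by norm_num)
  refine ae_eq_of_integral_contDiff_smul_eq (hloc _) ?_ fun g hg hgs => ?_
  · exact (hloc _).continuous_smul (by fun_prop)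
  have hgc : HasCompactSupport (fun x => Complex.ofReal (g x)) :=
    hgs.comp_left (g := Complex.ofReal) Complex.ofReal_zero
  let ψ : 𝓢(E, ℂ) := hgc.toSchwartzMap (Complex.ofRealCLM.contDiff.comp hg)
  have htg : (fun x : E => Complex.ofReal (‖x‖ ^ 2)).HasTemperateGrowth := by fun_prop
  have h3 := DFunLike.congr_fun h2 ψ
  simp only [smul_apply, TemperedDistribution.smulLeftCLM_apply_apply,
    Lp.toTemperedDistribution_apply, SchwartzMap.smulLeftCLM_apply_apply htg] at h3
  have h4 : ∀ x, ψ x = Complex.ofReal (g x) := fun x => rfl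
  simp only [h4] at h3
  calc ∫ x, g x • (𝓕 w : Lp ℂ 2 volume) x = ∫ x, (g x : ℂ) • (𝓕 w : Lp ℂ 2 volume) x := by simp
    _ = _ := h3
    _ = _ := by
      rw [← integral_smul]
      congr 1 with x
      simp
      ring

/-- A linear isometry of the real `L²` space which diagonalises the Laplacian. -/
lemma exists_linearIsometry_diagonalizing_laplacian (E : Type*) [NormedAddCommGroup E]
    [InnerProductSpace ℝ E] [FiniteDimensional ℝ E] [MeasurableSpace E] [BorelSpace E] :
    ∃ R : Lp ℝ 2 (volume : Measure E) →ₗᵢ[ℝ] Lp ℂ 2 (volume : Measure E),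
      ∀ v w : Lp ℝ 2 (volume : Measure E),
        (∀ φ : 𝓢(E, ℝ), ∫ x, φ x * w x = ∫ x, Δ φ x * v x) →
        R w =ᵐ[volume] fun ξ => (-(2 * Real.pi * ‖ξ‖) ^ 2 : ℝ) • R v ξ := by
  let C : Lp ℝ 2 (volume : Measure E) →ₗᵢ[ℝ] Lp ℂ 2 (volume : Measure E) :=
    { (Complex.ofRealCLM.compLpL 2 volume : Lp ℝ 2 (volume : Measure E) →L[ℝ] _).toLinearMap with
      norm_map' := fun f => by
        refine le_antisymm ?_ ?_ <;> refine Lp.norm_le_norm_of_ae_le ?_ <;>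
        filter_upwards [Complex.ofRealCLM.coeFn_compLpL (𝕜 := ℝ) f] with x hx
        · exact (congrArg norm hx).le.trans (by simp)
        · exact (by simp : ‖f x‖ ≤ ‖Complex.ofRealCLM (f x)‖).trans (congrArg norm hx).ge }
  have hC : ∀ f, C f =ᵐ[volume] fun x => (f x : ℂ) := fun f =>
    Complex.ofRealCLM.coeFn_compLpL (𝕜 := ℝ) f
  let F : Lp ℂ 2 (volume : Measure E) →ₗᵢ[ℝ] Lp ℂ 2 (volume : Measure E) :=
    { (Lp.fourierTransformₗᵢ E ℂ).toLinearEquiv.toLinearMap.restrictScalars ℝ with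
      norm_map' := (Lp.fourierTransformₗᵢ E ℂ).norm_map }
  refine ⟨F.comp C, fun v w h => fourier_ae_eq_of_laplacian_eq fun φ => ?_⟩
  have h_int : ∀ (ψ : 𝓢(E, ℝ)) (u : Lp ℝ 2 (volume : Measure E)),
      Integrable fun x => ψ x * u x := fun ψ u => (ψ.memLp 2 volume).integrable_mul (Lp.memLp u)
  have hsplit : ∀ (ψ : 𝓢(E, ℂ)) (u : Lp ℝ 2 (volume : Measure E)), ∫ x, ψ x • C u x =
      (∫ x, ψ.postcompCLM Complex.reCLM x * u x : ℝ) +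
        (∫ x, ψ.postcompCLM Complex.imCLM x * u x : ℝ) * Complex.I := by
    intro ψ u
    rw [← integral_complex_ofReal, ← integral_complex_ofReal, ← integral_mul_const,
      ← integral_add]
    · refine integral_congr_ae ?_
      filter_upwards [hC u] with x hx
      rw [hx]
      apply Complex.ext <;> simp
    · exact (h_int _ u).ofReal
    · exact (h_int _ u).ofReal.mul_const _
  have hlap : ∀ L : ℂ →L[ℝ] ℝ, Δ (φ.postcompCLM L) = (Δ φ).postcompCLM L := by
    intro L
    ext x
    rw [SchwartzMap.laplacian_apply, SchwartzMap.postcompCLM_apply, SchwartzMap.laplacian_apply]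
    exact (φ.smooth 2).contDiffAt.laplacian_CLM_comp_left
  change ∫ x, φ x • C w x = ∫ x, Δ φ x • C v x
  rw [hsplit, hsplit, h, h, hlap, hlap]

/-- Multiplication by a bounded measurable function is a bounded operator on `L²`. -/
lemma exists_mul_bounded_operator {α F : Type*} [MeasurableSpace α] {μ : Measure α}
    [NormedAddCommGroup F] [InnerProductSpace ℝ F] {m : α → ℝ} (hm : Measurable m) {C : ℝ}
    (hC : ∀ x, ‖m x‖ ≤ C) :
    ∃ L : Lp F 2 μ →L[ℝ] Lp F 2 μ, ∀ f, L f =ᵐ[μ] fun x => m x • f x := by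
  have hmem : ∀ f : Lp F 2 μ, MemLp (fun x => m x • f x) 2 μ := fun f =>
    (Lp.memLp f).of_le_mul (hm.aestronglyMeasurable.smul (Lp.aestronglyMeasurable f))
      (Eventually.of_forall fun x => by
        rw [norm_smul]; exact mul_le_mul_of_nonneg_right (hC x) (norm_nonneg _))
  refine ⟨LinearMap.mkContinuous
    { toFun := fun f => (hmem f).toLp
      map_add' := fun f g => by
        rw [← MemLp.toLp_add]
        refine MemLp.toLp_congr _ _ ?_
        filter_upwards [Lp.coeFn_add f g] with x hx
        simp only [hx, Pi.add_apply, smul_add]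
      map_smul' := fun c f => by
        rw [RingHom.id_apply, ← MemLp.toLp_const_smul]
        refine MemLp.toLp_congr _ _ ?_
        filter_upwards [Lp.coeFn_smul c f] with x hx
        simp only [hx, Pi.smul_apply]
        exact smul_comm _ _ _ } C fun f => ?_, fun f => (hmem f).coeFn_toLp⟩
  refine Lp.norm_le_mul_norm_of_ae_le_mul ?_
  filter_upwards [(hmem f).coeFn_toLp] with x hx
  refine (congrArg norm hx).le.trans ?_
  rw [norm_smul]
  exact mul_le_mul_of_nonneg_right (hC x) (norm_nonneg _)

/-- Truncated multipliers factoring the symbol of the Laplacian. -/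
lemma exists_truncated_multipliers (E F : Type*) [NormedAddCommGroup E]
    [MeasurableSpace E] [BorelSpace E] [NormedAddCommGroup F] [InnerProductSpace ℝ F]
    (μ : Measure E) :
    ∃ M N : ℕ → Lp F 2 μ →L[ℝ] Lp F 2 μ,
      (∀ n x y, inner ℝ (M n x) y = inner ℝ x (M n y)) ∧
      (∀ m n, m ≤ n → ∀ x, ‖M m x‖ ≤ ‖M n x‖) ∧
      (∀ x, Tendsto (fun n => N n x) atTop (𝓝 x)) ∧
      (∀ n x, ‖N n x‖ ≤ ‖x‖) ∧
      ∀ v w : Lp F 2 μ, (w =ᵐ[μ] fun ξ => (-(2 * Real.pi * ‖ξ‖) ^ 2 : ℝ) • v ξ) →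
        ∀ n, N n w = -M n (M n v) := by
  let χ : ℕ → E → ℝ := fun n => (Metric.closedBall (0 : E) n).indicator fun _ => 1
  let ρ : ℕ → E → ℝ := fun n => (Metric.closedBall (0 : E) n).indicator fun ξ =>
    2 * Real.pi * ‖ξ‖
  have hχm : ∀ n, Measurable (χ n) := fun n =>
    measurable_const.indicator Metric.isClosed_closedBall.measurableSet
  have hρm : ∀ n, Measurable (ρ n) := fun n =>
    (measurable_norm.const_mul _).indicator Metric.isClosed_closedBall.measurableSet
  have hχ : ∀ n x, ‖χ n x‖ ≤ 1 := fun n x =>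
    (norm_indicator_le_norm_self _ _).trans (by simp)
  have hρ : ∀ n x, ‖ρ n x‖ ≤ 2 * Real.pi * n := by
    intro n x
    by_cases hx : x ∈ Metric.closedBall (0 : E) n
    · simp only [ρ, indicator_of_mem hx]
      rw [Real.norm_of_nonneg (by positivity)]
      have := mem_closedBall_zero_iff.1 hx
      gcongr
    · simp only [ρ, indicator_of_notMem hx, norm_zero]
      positivity
  choose N hN using fun n => exists_mul_bounded_operator (F := F) (μ := μ) (hχm n) (hχ n)
  choose M hM using fun n => exists_mul_bounded_operator (F := F) (μ := μ) (hρm n) (hρ n)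
  have hNle : ∀ n x, ‖N n x‖ ≤ ‖x‖ := by
    intro n f
    refine Lp.norm_le_norm_of_ae_le ?_
    filter_upwards [hN n f] with x hx
    rw [hx, norm_smul]
    exact mul_le_of_le_one_left (norm_nonneg _) (hχ n x)
  refine ⟨M, N, ?_, ?_, ?_, hNle, ?_⟩
  · intro n f g
    rw [L2.inner_def, L2.inner_def]
    refine integral_congr_ae ?_
    filter_upwards [hM n f, hM n g] with x hf hg
    rw [hf, hg, real_inner_smul_left, real_inner_smul_right]
  · intro m n hmn f
    refine Lp.norm_le_norm_of_ae_le ?_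
    filter_upwards [hM m f, hM n f] with x hm hn
    rw [hm, hn, norm_smul, norm_smul]
    refine mul_le_mul_of_nonneg_right ?_ (norm_nonneg _)
    exact norm_indicator_le_of_subset
      (Metric.closedBall_subset_closedBall (by exact_mod_cast hmn)) _ _
  · intro f
    rw [Lp.tendsto_Lp_iff_tendsto_eLpNorm']
    have key : ∀ n, eLpNorm (⇑(N n f) - ⇑f) 2 μ = eLpNorm (fun x => χ n x • f x - f x) 2 μ :=
      fun n => eLpNorm_congr_ae (by filter_upwards [hN n f] with x hx; simp [hx])
    simp_rw [key]
    have h2 : ∀ n, eLpNorm (fun x => χ n x • f x - f x) 2 μ =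
        (∫⁻ x, ‖χ n x • f x - f x‖ₑ ^ (2 : ℝ) ∂μ) ^ (1 / (2 : ℝ)) := fun n => by
      rw [eLpNorm_eq_lintegral_rpow_enorm_toReal (by norm_num) (by norm_num)]
      simp
    simp_rw [h2]
    have h0 : (0 : ENNReal) = 0 ^ (1 / (2 : ℝ)) := by simp
    rw [h0]
    refine Tendsto.ennrpow_const _ ?_
    have hfin : ∫⁻ x, ‖f x‖ₑ ^ (2 : ℝ) ∂μ ≠ ⊤ := by
      have := lintegral_rpow_enorm_lt_top_of_eLpNorm_lt_top (p := 2) (by norm_num)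
        (by norm_num) (Lp.memLp f).2
      simpa using this.ne
    rw [← lintegral_zero (μ := μ)]
    refine tendsto_lintegral_of_dominated_convergence' _ (fun n => ?_) (fun n => ?_) hfin ?_
    · exact (((hχm n).aestronglyMeasurable.smul (Lp.aestronglyMeasurable f)).sub
        (Lp.aestronglyMeasurable f)).enorm.pow_const _
    · refine Eventually.of_forall fun x => ?_
      refine ENNReal.rpow_le_rpow ?_ (by norm_num)
      by_cases hx : x ∈ Metric.closedBall (0 : E) n
      · simp [χ, indicator_of_mem hx]
      · simp [χ, indicator_of_notMem hx]
    · refine Eventually.of_forall fun x => tendsto_const_nhds.congr' ?_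
      filter_upwards [eventually_ge_atTop ⌈‖x‖⌉₊] with n hn
      have hx : x ∈ Metric.closedBall (0 : E) n :=
        mem_closedBall_zero_iff.2 (Nat.ceil_le.1 hn)
      simp [χ, indicator_of_mem hx]
  · intro v w h n
    refine Lp.ext ?_
    filter_upwards [h, hN n w, Lp.coeFn_neg (M n (M n v)), hM n (M n v), hM n v]
      with x h1 h2 h3 h4 h5
    rw [h2, h3, Pi.neg_apply, h4, h5, h1, smul_smul, smul_smul, ← neg_smul]
    congr 1
    by_cases hx : x ∈ Metric.closedBall (0 : E) n
    · simp only [χ, ρ, indicator_of_mem hx]; ring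
    · simp only [χ, ρ, indicator_of_notMem hx]; ring

lemma ae_eq_zero_of_laplacian_primitive {E : Type*} [NormedAddCommGroup E]
    [InnerProductSpace ℝ E] [FiniteDimensional ℝ E] [MeasurableSpace E] [BorelSpace E]
    {T : ℝ} {U G : ℝ → Lp ℝ 2 (volume : Measure E)}
    (hU : MemLp U 2 (volume.restrict (Ioc 0 T))) (hG : MemLp G 2 (volume.restrict (Ioc 0 T)))
    (hUG : ∀ᵐ s ∂volume.restrict (Ioc 0 T), 0 ≤ inner ℝ (U s) (G s))
    (hGV : ∀ᵐ t ∂volume.restrict (Ioc 0 T), ∀ φ : 𝓢(E, ℝ),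
      ∫ x, φ x * G t x = ∫ x, Δ φ x * (∫ s in (0 : ℝ)..t, U s : Lp ℝ 2 (volume : Measure E)) x) :
    ∀ᵐ s ∂volume.restrict (Ioc 0 T), G s = 0 := by
  obtain ⟨R, hR⟩ := exists_linearIsometry_diagonalizing_laplacian E
  obtain ⟨M, N, hM, hMle, hN, hNle, hNM⟩ :=
    exists_truncated_multipliers E ℂ (volume : Measure E)
  have hUi : IntegrableOn U (Ioc 0 T) := hU.integrable (by norm_num)
  have h := ae_eq_zero_of_energy (U := fun s => R (U s)) (G := fun s => R (G s)) (T := T)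
    (R.toContinuousLinearMap.comp_memLp' hU) (R.toContinuousLinearMap.comp_memLp' hG)
    (by filter_upwards [hUG] with s hs; rwa [R.inner_map_map]) hM hMle hN hNle (by
      filter_upwards [hGV, ae_restrict_mem measurableSet_Ioc] with t ht htT n
      have hi : IntervalIntegrable U volume 0 t :=
        (intervalIntegrable_iff_integrableOn_Ioc_of_le htT.1.le).2
          (hUi.mono_set (Ioc_subset_Ioc_right htT.2))
      have := R.toContinuousLinearMap.intervalIntegral_comp_comm hi
      simp only [LinearIsometry.coe_toContinuousLinearMap] at this
      rw [this]
      exact hNM _ _ (hR _ _ ht) n)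
  filter_upwards [h] with s hs
  exact (map_eq_zero_iff R R.injective).1 hs

/-- The Laplacians of Schwartz functions are total in `L²`. -/
lemma eq_zero_of_integral_laplacian_mul_eq_zero {E : Type*} [NormedAddCommGroup E]
    [InnerProductSpace ℝ E] [FiniteDimensional ℝ E] [MeasurableSpace E] [BorelSpace E]
    [Nontrivial E] {v : Lp ℝ 2 (volume : Measure E)}
    (h : ∀ φ : 𝓢(E, ℝ), ∫ x, Δ φ x * v x = 0) : v = 0 := by
  obtain ⟨R, hR⟩ := exists_linearIsometry_diagonalizing_laplacian E
  have h0 := hR v 0 fun φ => by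
    simp [h φ]
  refine (map_eq_zero_iff R R.injective).1 (Lp.ext ?_)
  rw [map_zero] at h0
  have hne : ∀ᵐ x ∂(volume : Measure E), x ≠ 0 := by
    simp [ae_iff]
  filter_upwards [h0, Lp.coeFn_zero ℂ 2 (volume : Measure E), hne] with x h1 h2 h3
  rw [h2] at h1 ⊢
  have h4 : (-(2 * Real.pi * ‖x‖) ^ 2 : ℝ) ≠ 0 := by
    have := norm_pos_iff.2 h3
    have := Real.pi_pos
    exact neg_ne_zero.2 (by positivity)
  exact (smul_eq_zero.1 h1.symm).resolve_left h4

/-- Pettis measurability in separable Hilbert spaces, tested against a total set. -/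
lemma aestronglyMeasurable_of_aemeasurable_inner {α H : Type*} [MeasurableSpace α]
    {μ : Measure α} [NormedAddCommGroup H] [InnerProductSpace ℝ H] [CompleteSpace H]
    [SecondCountableTopology H] {U : α → H} {D : Set H}
    (hD : ∀ v, (∀ w ∈ D, inner ℝ w v = 0) → v = 0)
    (hU : ∀ w ∈ D, AEMeasurable (fun s => inner ℝ w (U s)) μ) : AEStronglyMeasurable U μ := by
  let S : Submodule ℝ H :=
    { carrier := {w | AEMeasurable (fun s => inner ℝ w (U s)) μ}
      zero_mem' := by simp
      add_mem' := fun {v w} hv hw => by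
        simp only [mem_ofPred_eq, inner_add_left] at *
        exact hv.add hw
      smul_mem' := fun c w hw => by
        simp only [mem_ofPred_eq, real_inner_smul_left] at *
        exact hw.const_mul c }
  have hSc : IsClosed (S : Set H) := by
    refine isSeqClosed_iff_isClosed.1 fun u w hu huw => ?_
    exact aemeasurable_of_tendsto_metrizable_ae' (f := fun n s => inner ℝ (u n) (U s)) hu
      (Eventually.of_forall fun s => huw.inner tendsto_const_nhds)
  have hspan : (Submodule.span ℝ D).topologicalClosure = ⊤ := by
    rw [Submodule.topologicalClosure_eq_top_iff, Submodule.eq_bot_iff]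
    intro v hv
    exact hD v fun w hw => (Submodule.mem_orthogonal _ _).1 hv w (Submodule.subset_span hw)
  have hS : ∀ w, AEMeasurable (fun s => inner ℝ w (U s)) μ := by
    intro w
    have h1 : (Submodule.span ℝ D).topologicalClosure ≤ S :=
      Submodule.topologicalClosure_minimal _ (Submodule.span_le.2 hU) hSc
    exact h1 (hspan ▸ Submodule.mem_top)
  let e : ℕ → H := TopologicalSpace.denseSeq H
  let W : ℕ → Submodule ℝ H := fun n => Submodule.span ℝ (e '' Iio n)
  have hfin : ∀ n, FiniteDimensional ℝ (W n) := fun n =>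
    FiniteDimensional.span_of_finite ℝ ((finite_Iio n).image e)
  have hmono : Monotone W := fun m n h =>
    Submodule.span_mono (image_mono (Iio_subset_Iio h))
  have hdense : ⊤ ≤ (⨆ n, W n).topologicalClosure := by
    intro x _
    refine closure_mono ?_ (TopologicalSpace.denseRange_denseSeq H x)
    rintro _ ⟨n, rfl⟩
    exact le_iSup W (n + 1) (Submodule.subset_span ⟨n, Nat.lt_succ_self n, rfl⟩)
  refine aestronglyMeasurable_of_tendsto_ae atTop
    (f := fun n s => (W n).starProjection (U s)) (fun n => ?_)
    (Eventually.of_forall fun s => Submodule.starProjection_tendsto_self W hmono _ hdense)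
  have : ∀ s, (W n).starProjection (U s) =
      ∑ i, (inner ℝ (stdOrthonormalBasis ℝ (W n) i : H) (U s)) •
        (stdOrthonormalBasis ℝ (W n) i : H) := fun s => by
    rw [(stdOrthonormalBasis ℝ (W n)).starProjection_eq_sum_rankOne]
    simp
  simp_rw [this]
  exact Finset.aestronglyMeasurable_fun_sum _ fun i _ =>
    (hS _).aestronglyMeasurable.smul_const _

lemma laplacian_apply_eq_lap {d : ℕ} (φ : 𝓢(EuclideanSpace ℝ (Fin d), ℝ))
    (x : EuclideanSpace ℝ (Fin d)) : Δ φ x = lap φ x := by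
  rw [SchwartzMap.laplacian_apply,
    InnerProductSpace.laplacian_eq_iteratedFDeriv_orthonormalBasis _
      (EuclideanSpace.basisFun (Fin d) ℝ)]
  simp [lap]

/-- Signed measures are determined by the integrals of bounded continuous functions. -/
lemma signedMeasure_eq_of_forall_sintegral_eq {E : Type*} [TopologicalSpace E]
    [HasOuterApproxClosed E] [MeasurableSpace E] [BorelSpace E] {z₁ z₂ : SignedMeasure E}
    (h : ∀ φ : BoundedContinuousFunction E ℝ, sintegral z₁ φ = sintegral z₂ φ) : z₁ = z₂ := by
  have key : z₁.toJordanDecomposition.posPart + z₂.toJordanDecomposition.negPart =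
      z₂.toJordanDecomposition.posPart + z₁.toJordanDecomposition.negPart := by
    refine ext_of_forall_integral_eq_of_IsFiniteMeasure fun φ => ?_
    rw [integral_add_measure (φ.integrable _) (φ.integrable _),
      integral_add_measure (φ.integrable _) (φ.integrable _)]
    have := h φ
    simp only [sintegral] at this
    linarith
  ext A hA
  rw [signedMeasure_apply_eq_real_sub z₁ hA, signedMeasure_apply_eq_real_sub z₂ hA]
  have := congrArg (fun μ : Measure E => μ.real A) key
  beta_reduce at this
  rw [measureReal_add_apply, measureReal_add_apply] at this
  linarith

lemma sintegral_add {α : Type*} [MeasurableSpace α] {z : SignedMeasure α} {f g : α → ℝ}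
    (hf : ∀ μ : Measure α, IsFiniteMeasure μ → Integrable f μ)
    (hg : ∀ μ : Measure α, IsFiniteMeasure μ → Integrable g μ) :
    sintegral z (fun x => f x + g x) = sintegral z f + sintegral z g := by
  simp only [sintegral]
  rw [integral_add (hf _ inferInstance) (hg _ inferInstance),
    integral_add (hf _ inferInstance) (hg _ inferInstance)]
  ring

lemma aemeasurable_sintegral_of_continuousOn {E : Type*} [PseudoEMetricSpace E] [MeasurableSpace E]
    [BorelSpace E] [MeasurableSpace.CountablyGenerated E] {T : ℝ} (hT : 0 ≤ T)
    {z : ℝ → SignedMeasure E}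
    (hz : ∀ φ : BoundedContinuousFunction E ℝ, ContinuousOn (fun s => sintegral (z s) φ) (Icc 0 T))
    {f : ℝ → E → ℝ} (hf : Measurable (Function.uncurry f)) :
    AEMeasurable (fun s => sintegral (z s) (f s)) (volume.restrict (Ioc 0 T)) := by
  have h1 : Measurable fun s => sintegral (z (projIcc 0 T hT s)) (f s) := by
    refine measurable_sintegral (fun A hA => measurable_apply_of_continuous_sintegral
      (z := fun s => z (projIcc 0 T hT s)) (fun φ => ?_) hA) hf
    exact (hz φ).domRestrict.comp continuous_projIcc
  refine h1.aemeasurable.congr ?_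
  filter_upwards [ae_restrict_mem measurableSet_Ioc] with s hs
  rw [projIcc_of_mem hT ⟨hs.1.le, hs.2⟩]

lemma enorm_sintegral_sub_le {α : Type*} [MeasurableSpace α] {ν : Measure α} [SigmaFinite ν]
    {z₁ z₂ : SignedMeasure α} {g : α → ℝ} (hgm : Measurable g) (hg : Integrable g ν)
    (h : ∀ A, MeasurableSet A → (z₁ - z₂) A = ∫ x in A, g x ∂ν) {f : α → ℝ} (hf : Measurable f) :
    ‖sintegral z₁ f - sintegral z₂ f‖ₑ ≤ ∫⁻ x, ‖f x * g x‖ₑ ∂ν := by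
  obtain ⟨k, hkm, hk, hsum, -⟩ := exists_sintegral_sub_mem hgm hg h
  by_cases hi : Integrable (fun x => f x * g x) ν
  · have hle : ∀ c : α → ℝ, (∀ᵐ x ∂ν, |c x| ≤ |g x|) →
        ‖∫ x, f x * c x ∂ν‖ₑ ≤ ∫⁻ x, ‖f x * g x‖ₑ ∂ν := by
      intro c hc
      refine (enorm_integral_le_lintegral_enorm _).trans (lintegral_mono_ae ?_)
      filter_upwards [hc] with x hx
      rw [enorm_mul, enorm_mul]
      gcongr
      exact enorm_le_iff_norm_le.2 hx
    rcases hsum f hf hi with h0 | h0 | h0 | h0 <;> rw [h0]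
    · simp
    · refine hle _ ?_
      filter_upwards [hk] with x hx
      rcases le_total (g x) 0 with h1 | h1
      · rw [min_eq_left h1, max_eq_right h1] at hx
        rw [abs_of_nonpos h1, abs_of_nonpos hx.2]; linarith
      · rw [min_eq_right h1, max_eq_left h1] at hx
        rw [abs_of_nonneg h1, abs_of_nonneg hx.1]; linarith
    · refine hle _ ?_
      filter_upwards [hk] with x hx
      rcases le_total (g x) 0 with h1 | h1
      · rw [min_eq_left h1, max_eq_right h1] at hx
        rw [abs_of_nonpos h1, abs_of_nonpos (by linarith)]; linarith
      · rw [min_eq_right h1, max_eq_left h1] at hx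
        rw [abs_of_nonneg h1, abs_of_nonneg (by linarith)]; linarith
    · exact hle _ (by simp)
  · refine le_of_le_of_eq le_top (Eq.symm ?_)
    by_contra hne
    exact hi ⟨(hf.mul hgm).aestronglyMeasurable, lt_top_iff_ne_top.2 hne⟩

lemma memLp_two_slices {E : Type*} [MeasurableSpace E] {ν : Measure E} [SFinite ν]
    {μ : Measure ℝ} [SFinite μ] {f : ℝ → E → ℝ} (hf : Measurable (Function.uncurry f))
    (h : ∫⁻ p, ENNReal.ofReal (f p.1 p.2 ^ 2) ∂(μ.prod ν) < ⊤) :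
    (∀ᵐ s ∂μ, MemLp (f s) 2 ν) ∧ ∫⁻ s, eLpNorm (f s) 2 ν ^ 2 ∂μ < ⊤ := by
  have hsq : ∀ s, eLpNorm (f s) 2 ν ^ 2 = ∫⁻ x, ENNReal.ofReal (f s x ^ 2) ∂ν := by
    intro s
    rw [eLpNorm_eq_lintegral_rpow_enorm_toReal (by norm_num) (by norm_num), ← ENNReal.rpow_natCast,
      ← ENNReal.rpow_mul]
    simp only [ENNReal.toReal_ofNat, one_div, Nat.cast_ofNat]
    norm_num
    refine lintegral_congr fun x => ?_
    rw [Real.enorm_eq_ofReal_abs, ← ENNReal.ofReal_pow (abs_nonneg _), sq_abs]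
  have hm : Measurable fun p : ℝ × E => ENNReal.ofReal (f p.1 p.2 ^ 2) :=
    ENNReal.measurable_ofReal.comp (hf.pow_const 2)
  have h2 : ∫⁻ s, eLpNorm (f s) 2 ν ^ 2 ∂μ < ⊤ := by
    simp_rw [hsq]
    rwa [lintegral_prod _ hm.aemeasurable] at h
  refine ⟨?_, h2⟩
  have hm2 : Measurable fun s => eLpNorm (f s) 2 ν ^ 2 := by
    simp_rw [hsq]
    exact hm.lintegral_prod_right'
  filter_upwards [ae_lt_top hm2 h2.ne] with s hs
  refine ⟨(hf.of_uncurry_left).aestronglyMeasurable, ?_⟩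
  by_contra hne
  rw [not_lt_top_iff.1 hne] at hs
  simp at hs

/-- A rational-linear functional given pointwise by differences of signed integrals (or zero) is
represented by a single `L²` function with the sign of the density. -/
lemma exists_flux {α X : Type*} [MeasurableSpace α] {ν : Measure α} [SigmaFinite ν]
    [AddCommGroup X] [Module ℚ X] {z₁ z₂ : SignedMeasure α} {g b : α → ℝ} (hgm : Measurable g)
    (hg : Integrable g ν) (h : ∀ A, MeasurableSet A → (z₁ - z₂) A = ∫ x in A, g x ∂ν)
    (hbm : Measurable b) (hb : ∀ x, 0 ≤ b x) (hbg : MemLp (fun x => b x * g x) 2 ν)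
    {p : X → α → ℝ} (hp_add : ∀ x y r, p (x + y) r = p x r + p y r)
    (hpm : ∀ x, Measurable (p x)) (hp : ∀ x, MemLp (p x) 2 ν) {J : X → ℝ}
    (hJ_add : ∀ x y, J (x + y) = J x + J y)
    (hJ : ∀ x, J x = 0 ∨ J x =
      sintegral z₁ (fun r => p x r * b r) - sintegral z₂ (fun r => p x r * b r)) :
    ∃ u : Lp ℝ 2 ν, (∀ᵐ r ∂ν, ‖u r‖ ≤ ‖b r * g r‖) ∧ (∀ᵐ r ∂ν, 0 ≤ u r * g r) ∧
      ∀ x, J x = ∫ r, p x r * u r ∂ν := by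
  obtain ⟨k, hkm, hk, hsum, -⟩ := exists_sintegral_sub_mem hgm hg h
  let c : Fin 4 → α → ℝ := ![fun _ => 0, k, fun r => g r - k r, g]
  have hcm : ∀ i, Measurable (c i) := by
    intro i
    fin_cases i
    exacts [measurable_const, hkm, hgm.sub hkm, hgm]
  have hc : ∀ i, ∀ᵐ r ∂ν, min (g r) 0 ≤ c i r ∧ c i r ≤ max (g r) 0 := by
    intro i
    fin_cases i
    · exact Eventually.of_forall fun r => ⟨min_le_right _ _, le_max_right _ _⟩
    · exact hk
    · filter_upwards [hk] with r hr
      have := min_add_max (g r) 0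
      change _ ≤ g r - k r ∧ g r - k r ≤ _
      constructor <;> linarith [hr.1, hr.2]
    · exact Eventually.of_forall fun r => ⟨min_le_left _ _, le_max_left _ _⟩
  have habs : ∀ i, ∀ᵐ r ∂ν, ‖b r * c i r‖ ≤ ‖b r * g r‖ := by
    intro i
    filter_upwards [hc i] with r hr
    rw [norm_mul, norm_mul]
    refine mul_le_mul_of_nonneg_left ?_ (norm_nonneg _)
    rw [Real.norm_eq_abs, Real.norm_eq_abs]
    rcases le_total (g r) 0 with h1 | h1
    · rw [min_eq_left h1, max_eq_right h1] at hr
      rw [abs_of_nonpos h1, abs_of_nonpos hr.2]; linarith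
    · rw [min_eq_right h1, max_eq_left h1] at hr
      rw [abs_of_nonneg h1, abs_of_nonneg hr.1]; linarith
  have hbc : ∀ i, MemLp (fun r => b r * c i r) 2 ν := fun i =>
    hbg.mono (hbm.mul (hcm i)).aestronglyMeasurable (habs i)
  let L : Fin 4 → X →+ ℝ := fun i => AddMonoidHom.mk' (fun x => ∫ r, p x r * (b r * c i r) ∂ν)
    fun x y => by
      simp_rw [hp_add, add_mul]
      exact integral_add ((hp x).integrable_mul (hbc i)) ((hp y).integrable_mul (hbc i))
  obtain ⟨i, hi⟩ := exists_linearMap_eq_of_forall_exists_eq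
    (AddMonoidHom.mk' J hJ_add).toRatLinearMap (fun i => (L i).toRatLinearMap) (by
      intro x
      have hL0 : L 0 x = 0 := by
        change ∫ r, p x r * (b r * 0) ∂ν = 0
        simp
      rcases hJ x with h0 | h0
      · exact ⟨0, h0.trans hL0.symm⟩
      · have h_int : Integrable (fun r => p x r * b r * g r) ν := by
          simpa only [mul_assoc] using! (hp x).integrable_mul hbg
        rcases hsum _ ((hpm x).mul hbm) h_int with h1 | h1 | h1 | h1
        · exact ⟨0, (h0.trans h1).trans hL0.symm⟩
        · refine ⟨1, (h0.trans h1).trans ?_⟩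
          exact integral_congr_ae (Eventually.of_forall fun r => mul_assoc _ _ _)
        · refine ⟨2, (h0.trans h1).trans ?_⟩
          exact integral_congr_ae (Eventually.of_forall fun r => mul_assoc _ _ _)
        · refine ⟨3, (h0.trans h1).trans ?_⟩
          exact integral_congr_ae (Eventually.of_forall fun r => mul_assoc _ _ _))
  refine ⟨(hbc i).toLp, ?_, ?_, fun x => ?_⟩
  · filter_upwards [(hbc i).coeFn_toLp, habs i] with r h1 h2
    rwa [h1]
  · filter_upwards [(hbc i).coeFn_toLp, hc i] with r h1 hr
    rw [h1, mul_assoc]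
    refine mul_nonneg (hb r) ?_
    rcases le_total (g r) 0 with h2 | h2
    · rw [min_eq_left h2, max_eq_right h2] at hr
      exact mul_nonneg_of_nonpos_of_nonpos hr.2 h2
    · rw [min_eq_right h2, max_eq_left h2] at hr
      exact mul_nonneg hr.1 h2
  · refine (LinearMap.congr_fun hi x).trans (integral_congr_ae ?_)
    filter_upwards [(hbc i).coeFn_toLp] with r h1
    rw [h1]

lemma inner_toLp_eq_integral_mul {E : Type*} [NormedAddCommGroup E] [InnerProductSpace ℝ E]
    [FiniteDimensional ℝ E] [MeasurableSpace E] [BorelSpace E] (φ : 𝓢(E, ℝ))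
    (u : Lp ℝ 2 (volume : Measure E)) :
    inner ℝ (φ.toLp 2 volume) u = ∫ x, φ x * u x := by
  rw [L2.inner_def]
  refine integral_congr_ae ?_
  filter_upwards [φ.coeFn_toLp 2 volume] with x hx
  rw [hx, real_inner_eq_re_inner, RCLike.inner_apply]
  simp [mul_comm]

/-- The primitives of the fluxes tested against a countable family. -/
lemma exists_primitive_flux {E : Type*} [NormedAddCommGroup E] [InnerProductSpace ℝ E]
    [FiniteDimensional ℝ E] [MeasurableSpace E] [BorelSpace E] {T : ℝ} (hT : 0 < T)
    {a : ℝ → E → ℝ} (ha : Measurable (Function.uncurry a)) {z₁ z₂ : ℝ → SignedMeasure E}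
    {z0 : SignedMeasure E}
    (hc₁ : ∀ φ : BoundedContinuousFunction E ℝ,
      ContinuousOn (fun t => sintegral (z₁ t) φ) (Icc 0 T))
    (hc₂ : ∀ φ : BoundedContinuousFunction E ℝ,
      ContinuousOn (fun t => sintegral (z₂ t) φ) (Icc 0 T))
    {g : ℝ → E → ℝ} (hg : Measurable (Function.uncurry g))
    (hdens : ∀ᵐ s ∂volume.restrict (Ioc 0 T), ∀ A : Set E, MeasurableSet A →
      (z₁ s - z₂ s) A = ∫ x in A, g s x)
    (hgi : ∀ᵐ s ∂volume.restrict (Ioc 0 T), Integrable (g s))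
    (hag : ∫⁻ s in Ioc 0 T, eLpNorm (fun x => a s x * g s x) 2 volume ^ 2 < ⊤)
    (φ : 𝓢(E, ℝ))
    (hs₁ : ∀ t ∈ Icc (0 : ℝ) T, sintegral (z₁ t) φ =
      sintegral z0 φ + ∫ s in (0 : ℝ)..t, sintegral (z₁ s) (fun x => Δ φ x * a s x))
    (hs₂ : ∀ t ∈ Icc (0 : ℝ) T, sintegral (z₂ t) φ =
      sintegral z0 φ + ∫ s in (0 : ℝ)..t, sintegral (z₂ s) (fun x => Δ φ x * a s x)) :
    ∃ J : ℝ → ℝ, IntegrableOn J (Ioc 0 T) ∧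
      (∀ s, J s = 0 ∨ J s = sintegral (z₁ s) (fun x => Δ φ x * a s x) -
        sintegral (z₂ s) (fun x => Δ φ x * a s x)) ∧
      ∀ t ∈ Icc 0 T, sintegral (z₁ t) φ - sintegral (z₂ t) φ = ∫ s in (0 : ℝ)..t, J s := by
  have hm : Measurable (Function.uncurry fun s x => Δ φ x * a s x) :=
    ((Δ φ).continuous.measurable.comp measurable_snd).mul ha
  refine exists_primitive_of_eq_sub hT ?_ ?_ fun t ht => ?_
  · refine MemLp.integrable (q := 2) (by norm_num) ⟨?_, ?_⟩
    · exact ((aemeasurable_sintegral_of_continuousOn hT.le hc₁ hm).sub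
        (aemeasurable_sintegral_of_continuousOn hT.le hc₂ hm)).aestronglyMeasurable
    · rw [eLpNorm_lt_top_iff_lintegral_rpow_enorm_lt_top (by norm_num) (by norm_num)]
      have hle : ∀ᵐ s ∂volume.restrict (Ioc 0 T),
          ‖sintegral (z₁ s) (fun x => Δ φ x * a s x) -
            sintegral (z₂ s) (fun x => Δ φ x * a s x)‖ₑ ^ (ENNReal.toReal 2) ≤
          eLpNorm (⇑(Δ φ : 𝓢(E, ℝ))) 2 (volume : Measure E) ^ 2 *
            eLpNorm (fun x => a s x * g s x) 2 (volume : Measure E) ^ 2 := by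
        filter_upwards [hdens, hgi] with s h1 h2
        have h3 := enorm_sintegral_sub_le hg.of_uncurry_left h2 h1
          (f := fun x => Δ φ x * a s x) hm.of_uncurry_left
        have h4 : ∫⁻ x, ‖Δ φ x * a s x * g s x‖ₑ ≤
            eLpNorm (⇑(Δ φ : 𝓢(E, ℝ))) 2 (volume : Measure E) *
            eLpNorm (fun x => a s x * g s x) 2 (volume : Measure E) := by
          have h5 := eLpNorm_smul_le_mul_eLpNorm (μ := (volume : Measure E)) (p := 2) (q := 2)
            (r := 1) (f := fun x => a s x * g s x) (φ := ⇑(Δ φ : 𝓢(E, ℝ)))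
            (ha.of_uncurry_left.mul hg.of_uncurry_left).aestronglyMeasurable
            (Δ φ).continuous.aestronglyMeasurable
          rw [eLpNorm_one_eq_lintegral_enorm] at h5
          refine le_of_eq_of_le (lintegral_congr fun x => ?_) h5
          simp [mul_assoc]
        rw [← mul_pow, ENNReal.toReal_ofNat, ← ENNReal.rpow_natCast, Nat.cast_ofNat]
        exact ENNReal.rpow_le_rpow (h3.trans h4) (by norm_num)
      refine (lintegral_mono_ae hle).trans_lt ?_
      have hfin : eLpNorm (⇑(Δ φ : 𝓢(E, ℝ))) 2 (volume : Measure E) ^ 2 ≠ ⊤ :=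
        ENNReal.pow_ne_top ((Δ φ).memLp 2 volume).2.ne
      rw [lintegral_const_mul' _ _ hfin]
      exact ENNReal.mul_lt_top (lt_top_iff_ne_top.2 hfin) hag
  · exact (hc₁ φ.toBoundedContinuousFunction).sub (hc₂ φ.toBoundedContinuousFunction)
  · rw [hs₁ t ht, hs₂ t ht]; ring

/-- The difference of the fluxes is represented by a square integrable process `U`, with
`U * g ≥ 0`, whose primitive `V` satisfies `g = Δ V`. -/
lemma exists_flux_process {E : Type*} [NormedAddCommGroup E] [InnerProductSpace ℝ E]
    [FiniteDimensional ℝ E] [Nontrivial E] [MeasurableSpace E] [BorelSpace E] {T : ℝ} (hT : 0 < T)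
    {a : ℝ → E → ℝ} (ha : Measurable (Function.uncurry a)) (ha0 : ∀ s x, 0 ≤ a s x)
    {z₁ z₂ : ℝ → SignedMeasure E} {z0 : SignedMeasure E}
    (hc₁ : ∀ φ : BoundedContinuousFunction E ℝ,
      ContinuousOn (fun t => sintegral (z₁ t) φ) (Icc 0 T))
    (hc₂ : ∀ φ : BoundedContinuousFunction E ℝ,
      ContinuousOn (fun t => sintegral (z₂ t) φ) (Icc 0 T))
    {g : ℝ → E → ℝ} (hg : Measurable (Function.uncurry g))
    (hdens : ∀ᵐ s ∂volume.restrict (Ioc 0 T), ∀ A : Set E, MeasurableSet A →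
      (z₁ s - z₂ s) A = ∫ x in A, g s x)
    (hgi : ∀ᵐ s ∂volume.restrict (Ioc 0 T), Integrable (g s))
    (hg2 : ∀ᵐ s ∂volume.restrict (Ioc 0 T), MemLp (g s) 2)
    (hag2 : ∀ᵐ s ∂volume.restrict (Ioc 0 T), MemLp (fun x => a s x * g s x) 2)
    (hag : ∫⁻ s in Ioc 0 T, eLpNorm (fun x => a s x * g s x) 2 volume ^ 2 < ⊤)
    (hs₁ : ∀ φ : 𝓢(E, ℝ), ∀ t ∈ Icc (0 : ℝ) T, sintegral (z₁ t) φ =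
      sintegral z0 φ + ∫ s in (0 : ℝ)..t, sintegral (z₁ s) (fun x => Δ φ x * a s x))
    (hs₂ : ∀ φ : 𝓢(E, ℝ), ∀ t ∈ Icc (0 : ℝ) T, sintegral (z₂ t) φ =
      sintegral z0 φ + ∫ s in (0 : ℝ)..t, sintegral (z₂ s) (fun x => Δ φ x * a s x)) :
    ∃ U : ℝ → Lp ℝ 2 (volume : Measure E), MemLp U 2 (volume.restrict (Ioc 0 T)) ∧
      (∀ᵐ s ∂volume.restrict (Ioc 0 T), ∀ᵐ x, 0 ≤ U s x * g s x) ∧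
      ∀ᵐ t ∂volume.restrict (Ioc 0 T), ∀ φ : 𝓢(E, ℝ), ∫ x, φ x * g t x =
        ∫ x, Δ φ x * (∫ s in (0 : ℝ)..t, U s : Lp ℝ 2 (volume : Measure E)) x := by
  have : Fact ((2 : ENNReal) ≠ ⊤) := ⟨by norm_num⟩
  obtain ⟨q, hq⟩ := exists_rat_addMonoidHom_dense (V := 𝓢(E, ℝ))
    (W := Lp ℝ 2 (volume : Measure E) × Lp ℝ 2 (volume : Measure E))
    (fun φ => (φ.toLp 2 volume, (Δ φ).toLp 2 volume))
  choose J hJi hJ hJp using fun x => exists_primitive_flux hT ha hc₁ hc₂ hg hdens hgi hag (q x)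
    (hs₁ (q x)) (hs₂ (q x))
  have hJt : ∀ x, ∀ t ∈ Icc 0 T, IntervalIntegrable (J x) volume 0 t := fun x t ht =>
    (intervalIntegrable_iff_integrableOn_Ioc_of_le ht.1).2
      ((hJi x).mono_set (Ioc_subset_Ioc_right ht.2))
  have hadd : ∀ᵐ s ∂volume.restrict (Ioc 0 T), ∀ x y, J (x + y) s = J x s + J y s := by
    rw [ae_all_iff]; intro x
    rw [ae_all_iff]; intro y
    have h0 := ae_eq_zero_of_primitive_eq_zero hT
      (J := fun s => J (x + y) s - (J x s + J y s)) ((hJi _).sub ((hJi x).add (hJi y))) (by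
        intro t ht
        rw [intervalIntegral.integral_sub (hJt _ t ht) ((hJt x t ht).add (hJt y t ht)),
          intervalIntegral.integral_add (hJt x t ht) (hJt y t ht), ← hJp _ t ht, ← hJp _ t ht,
          ← hJp _ t ht]
        have hs : ∀ z : SignedMeasure E,
            sintegral z (q (x + y)) = sintegral z (q x) + sintegral z (q y) := fun z => by
          rw [map_add]
          exact sintegral_add (fun μ _ => (q x).integrable) (fun μ _ => (q y).integrable)
        rw [hs, hs]; ring)
    filter_upwards [h0] with s hs
    exact sub_eq_zero.1 hs
  have hex : ∀ᵐ s ∂volume.restrict (Ioc 0 T), ∃ u : Lp ℝ 2 (volume : Measure E),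
      (∀ᵐ r, ‖u r‖ ≤ ‖a s r * g s r‖) ∧ (∀ᵐ r, 0 ≤ u r * g s r) ∧
      ∀ x, J x s = ∫ r, Δ (q x) r * u r := by
    filter_upwards [hdens, hgi, hag2, hadd] with s h1 h2 h3 h4
    refine exists_flux hg.of_uncurry_left h2 h1 ha.of_uncurry_left (ha0 s) h3
      (p := fun x r => Δ (q x) r) (fun x y r => ?_) (fun x => (Δ (q x)).continuous.measurable)
      (fun x => (Δ (q x)).memLp 2 volume) (J := fun x => J x s) h4 fun x => hJ x s
    simp only [← SchwartzMap.laplacianCLM_eq', map_add, add_apply]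
  classical
  let U : ℝ → Lp ℝ 2 (volume : Measure E) := fun s =>
    if h : ∃ u : Lp ℝ 2 (volume : Measure E),
      (∀ᵐ r, ‖u r‖ ≤ ‖a s r * g s r‖) ∧ (∀ᵐ r, 0 ≤ u r * g s r) ∧
      ∀ x, J x s = ∫ r, Δ (q x) r * u r then h.choose else 0
  have hU : ∀ᵐ s ∂volume.restrict (Ioc 0 T),
      (∀ᵐ r, ‖U s r‖ ≤ ‖a s r * g s r‖) ∧ (∀ᵐ r, 0 ≤ U s r * g s r) ∧
      ∀ x, J x s = ∫ r, Δ (q x) r * U s r := by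
    filter_upwards [hex] with s hs
    simp only [U, dif_pos hs]
    exact hs.choose_spec
  have hUm : AEStronglyMeasurable U (volume.restrict (Ioc 0 T)) := by
    refine aestronglyMeasurable_of_aemeasurable_inner
      (D := range fun x => (Δ (q x)).toLp 2 volume) (fun v hv => ?_) ?_
    · refine eq_zero_of_integral_laplacian_mul_eq_zero fun φ => ?_
      have hcl : IsClosed {w : Lp ℝ 2 (volume : Measure E) × Lp ℝ 2 (volume : Measure E) |
          inner ℝ w.2 v = 0} :=
        isClosed_eq (continuous_snd.inner continuous_const) continuous_const
      have := hcl.closure_subset_iff.2 (by rintro _ ⟨x, rfl⟩; exact hv _ ⟨x, rfl⟩) (hq φ)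
      rw [← inner_toLp_eq_integral_mul]
      exact this
    · rintro _ ⟨x, rfl⟩
      refine (hJi x).aemeasurable.congr ?_
      filter_upwards [hU] with s hs
      rw [inner_toLp_eq_integral_mul, hs.2.2 x]
  have hU2 : MemLp U 2 (volume.restrict (Ioc 0 T)) := by
    refine ⟨hUm, ?_⟩
    rw [eLpNorm_lt_top_iff_lintegral_rpow_enorm_lt_top (by norm_num) (by norm_num)]
    refine (lintegral_mono_ae ?_).trans_lt hag
    filter_upwards [hU] with s hs
    rw [ENNReal.toReal_ofNat, ← ENNReal.rpow_natCast, Nat.cast_ofNat, Lp.enorm_def]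
    exact ENNReal.rpow_le_rpow (eLpNorm_mono_ae hs.1) (by norm_num)
  refine ⟨U, hU2, hU.mono fun s hs => hs.2.1, ?_⟩
  have hUi : IntegrableOn U (Ioc 0 T) := hU2.integrable (by norm_num)
  filter_upwards [hdens, hgi, hg2, ae_restrict_mem measurableSet_Ioc] with t h1 h2 h3 ht φ
  have hUt : IntervalIntegrable U volume 0 t :=
    (intervalIntegrable_iff_integrableOn_Ioc_of_le ht.1.le).2
      (hUi.mono_set (Ioc_subset_Ioc_right ht.2))
  have hgt : ∀ ψ : 𝓢(E, ℝ), ∫ x, ψ x * g t x = inner ℝ (ψ.toLp 2 volume) h3.toLp := by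
    intro ψ
    rw [inner_toLp_eq_integral_mul]
    refine integral_congr_ae ?_
    filter_upwards [h3.coeFn_toLp] with x hx
    rw [hx]
  have hcl : IsClosed {w : Lp ℝ 2 (volume : Measure E) × Lp ℝ 2 (volume : Measure E) |
      inner ℝ w.1 h3.toLp = inner ℝ w.2 (∫ s in (0 : ℝ)..t, U s)} :=
    isClosed_eq (continuous_fst.inner continuous_const) (continuous_snd.inner continuous_const)
  have key := hcl.closure_subset_iff.2 (by
    rintro _ ⟨x, rfl⟩
    obtain ⟨-, -, -, -, hb⟩ := exists_sintegral_sub_mem hg.of_uncurry_left h2 h1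
    have hD := hb (q x) (q x).continuous.measurable
      ⟨_, (q x).toBoundedContinuousFunction.norm_coe_le_norm⟩
    have hV := (innerSL ℝ ((Δ (q x)).toLp 2 (volume : Measure E))).intervalIntegral_comp_comm hUt
    simp only [innerSL_apply_apply] at hV
    change inner ℝ ((q x).toLp 2 volume) h3.toLp = inner ℝ ((Δ (q x)).toLp 2 volume) _
    rw [← hgt, ← hD, hJp x t ⟨ht.1.le, ht.2⟩, ← hV]
    refine intervalIntegral.integral_congr_ae_restrict ?_
    rw [uIoc_of_le ht.1.le]
    filter_upwards [ae_restrict_of_ae_restrict_of_subset (Ioc_subset_Ioc_right ht.2) hU] with s hs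
    rw [inner_toLp_eq_integral_mul, hs.2.2 x]) (hq φ)
  rw [hgt, ← inner_toLp_eq_integral_mul]
  exact key

/-- A jointly measurable function with square integrable slices is a measurable `L²` process. -/
lemma exists_memLp_process {E : Type*} [NormedAddCommGroup E] [InnerProductSpace ℝ E]
    [FiniteDimensional ℝ E] [MeasurableSpace E] [BorelSpace E] {μ : Measure ℝ}
    {g : ℝ → E → ℝ} (hg : Measurable (Function.uncurry g)) (hg2 : ∀ᵐ s ∂μ, MemLp (g s) 2)
    (hfin : ∫⁻ s, eLpNorm (g s) 2 volume ^ 2 ∂μ < ⊤) :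
    ∃ G : ℝ → Lp ℝ 2 (volume : Measure E), MemLp G 2 μ ∧ ∀ᵐ s ∂μ, G s =ᵐ[volume] g s := by
  classical
  have : Fact ((2 : ENNReal) ≠ ⊤) := ⟨by norm_num⟩
  let G : ℝ → Lp ℝ 2 (volume : Measure E) := fun s =>
    if h : MemLp (g s) 2 volume then h.toLp else 0
  have hG : ∀ᵐ s ∂μ, G s =ᵐ[volume] g s := by
    filter_upwards [hg2] with s hs
    simp only [G, dif_pos hs]
    exact hs.coeFn_toLp
  refine ⟨G, ⟨aestronglyMeasurable_of_aemeasurable_inner (D := univ)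
    (fun v hv => inner_self_eq_zero.1 (hv v (mem_univ v))) fun w _ => ?_, ?_⟩, hG⟩
  · have hw : StronglyMeasurable (Function.uncurry fun s x => w x * g s x) :=
      (((Lp.stronglyMeasurable w).measurable.comp measurable_snd).mul hg).stronglyMeasurable
    refine (hw.integral_prod_right (ν := volume)).measurable.aemeasurable.congr ?_
    filter_upwards [hG] with s hs
    rw [L2.inner_def]
    refine integral_congr_ae ?_
    filter_upwards [hs] with x hx
    rw [hx, real_inner_eq_re_inner, RCLike.inner_apply]
    simp [mul_comm]
  · rw [eLpNorm_lt_top_iff_lintegral_rpow_enorm_lt_top (by norm_num) (by norm_num)]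
    refine (lintegral_mono_ae ?_).trans_lt hfin
    filter_upwards [hG] with s hs
    rw [ENNReal.toReal_ofNat, ← ENNReal.rpow_natCast, Nat.cast_ofNat, Lp.enorm_def,
      eLpNorm_congr_ae hs]

/-- uniqueness for the Fokker-Planck equation ∂_t z = Δ(a z) in ℝ^d under
Hypothesis (B1): the difference of two weakly continuous measure-valued distributional
solutions with the same initial condition admits a density g ∈ L¹_loc([0,T]×ℝ^d) with
∫|g|² < ∞ and ∫|a g|² < ∞; then the two solutions coincide for every t ∈ [0,T]. -/
theorem fokkerPlanck_uniqueness_multidim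
    (d : ℕ) (hd : 1 ≤ d) (T : ℝ) (hT : 0 < T)
    (a : ℝ → EuclideanSpace ℝ (Fin d) → ℝ)
    (ha_meas : Measurable (Function.uncurry a))
    (ha_nonneg : ∀ t x, 0 ≤ a t x)
    (z₁ z₂ : ℝ → MeasureTheory.SignedMeasure (EuclideanSpace ℝ (Fin d)))
    (z0 : MeasureTheory.SignedMeasure (EuclideanSpace ℝ (Fin d)))
    -- weak continuity of t ↦ z₁ t, z₂ t on [0,T]
    (hz₁cont : ∀ φ : BoundedContinuousFunction (EuclideanSpace ℝ (Fin d)) ℝ,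
      ContinuousOn (fun t => sintegral (z₁ t) φ) (Icc 0 T))
    (hz₂cont : ∀ φ : BoundedContinuousFunction (EuclideanSpace ℝ (Fin d)) ℝ,
      ContinuousOn (fun t => sintegral (z₂ t) φ) (Icc 0 T))
    -- both solve ∂_t z = Δ(a z) in the sense of distributions with initial condition z⁰
    (hz₁sol : ∀ φ : SchwartzMap (EuclideanSpace ℝ (Fin d)) ℝ, ∀ t ∈ Icc (0:ℝ) T,
      sintegral (z₁ t) φ
        = sintegral z0 φ + ∫ s in (0:ℝ)..t, sintegral (z₁ s) (fun x => lap φ x * a s x))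
    (hz₂sol : ∀ φ : SchwartzMap (EuclideanSpace ℝ (Fin d)) ℝ, ∀ t ∈ Icc (0:ℝ) T,
      sintegral (z₂ t) φ
        = sintegral z0 φ + ∫ s in (0:ℝ)..t, sintegral (z₂ s) (fun x => lap φ x * a s x))
    -- Hypothesis (B): z := z₁ - z₂ has a density g(t,·) for a.e. t, with g ∈ L¹_loc
    (g : ℝ → EuclideanSpace ℝ (Fin d) → ℝ)
    (hg_meas : Measurable (Function.uncurry g))
    (hg_dens : ∀ᵐ t ∂(volume.restrict (Icc (0:ℝ) T)),
      ∀ A : Set (EuclideanSpace ℝ (Fin d)), MeasurableSet A →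
        (z₁ t - z₂ t) A = ∫ x in A, g t x)
    (hg_loc : LocallyIntegrableOn (fun q : ℝ × EuclideanSpace ℝ (Fin d) => g q.1 q.2)
      (Icc (0:ℝ) T ×ˢ (univ : Set (EuclideanSpace ℝ (Fin d)))))
    -- (B1)(i): ∫_{[0,T]×ℝ^d} |z|² < ∞
    (hB1i : ∫⁻ q in Icc (0:ℝ) T ×ˢ (univ : Set (EuclideanSpace ℝ (Fin d))),
        ENNReal.ofReal ((g q.1 q.2) ^ 2) < ⊤)
    -- (B1)(ii): ∫_{[0,T]×ℝ^d} |a z|² < ∞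
    (hB1ii : ∫⁻ q in Icc (0:ℝ) T ×ˢ (univ : Set (EuclideanSpace ℝ (Fin d))),
        ENNReal.ofReal ((a q.1 q.2 * g q.1 q.2) ^ 2) < ⊤) :
    ∀ t ∈ Icc (0:ℝ) T, z₁ t = z₂ t := by
  have hnt : Nontrivial (EuclideanSpace ℝ (Fin d)) :=
    Module.nontrivial_of_finrank_pos (R := ℝ) (by rw [finrank_euclideanSpace_fin]; exact hd)
  have hle : volume.restrict (Ioc (0 : ℝ) T) ≤ volume.restrict (Icc 0 T) :=
    Measure.restrict_mono Ioc_subset_Icc_self le_rfl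
  have hprod : ∀ f : ℝ × EuclideanSpace ℝ (Fin d) → ENNReal,
      ∫⁻ p in Icc (0 : ℝ) T ×ˢ univ, f p < ⊤ →
      ∫⁻ p, f p ∂((volume.restrict (Ioc (0 : ℝ) T)).prod volume) < ⊤ := by
    intro f hf
    refine lt_of_le_of_lt (lintegral_mono' ?_ le_rfl) hf
    rw [Measure.volume_eq_prod, ← Measure.prod_restrict, Measure.restrict_univ]
    exact Measure.prod_mono hle le_rfl
  obtain ⟨hg2, hgfin⟩ := memLp_two_slices hg_meas (hprod _ hB1i)
  obtain ⟨hag2, hagfin⟩ := memLp_two_slices (f := fun s x => a s x * g s x)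
    (ha_meas.mul hg_meas) (hprod _ hB1ii)
  have hdens := ae_mono hle hg_dens
  have hgi : ∀ᵐ s ∂volume.restrict (Ioc 0 T), Integrable (g s) := by
    filter_upwards [hdens, hg2] with s h1 h2
    exact integrable_of_signedMeasure_apply_eq hg_meas.of_uncurry_left
      (h2.locallyIntegrable (by norm_num)) h1
  obtain ⟨U, hU, hUg, hUV⟩ := exists_flux_process hT ha_meas ha_nonneg hz₁cont hz₂cont hg_meas
    hdens hgi hg2 hag2 hagfin (z0 := z0)
    (fun φ t ht => by simpa only [laplacian_apply_eq_lap] using hz₁sol φ t ht)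
    (fun φ t ht => by simpa only [laplacian_apply_eq_lap] using hz₂sol φ t ht)
  obtain ⟨G, hG, hGg⟩ := exists_memLp_process hg_meas hg2 hgfin
  have hG0 := ae_eq_zero_of_laplacian_primitive hU hG
    (by
      filter_upwards [hUg, hGg] with s h1 h2
      rw [L2.inner_def]
      refine integral_nonneg_of_ae ?_
      filter_upwards [h1, h2] with x h3 h4
      rw [h4, real_inner_eq_re_inner, RCLike.inner_apply]
      simpa [mul_comm] using h3)
    (by
      filter_upwards [hUV, hGg] with t h1 h2 φ
      rw [← h1 φ]
      refine integral_congr_ae ?_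
      filter_upwards [h2] with x hx
      rw [hx])
  have hz : ∀ᵐ t ∂volume.restrict (Icc 0 T), z₁ t = z₂ t := by
    rw [← restrict_Ioc_eq_restrict_Icc]
    filter_upwards [hdens, hG0, hGg] with t h1 h2 h3
    have h4 : g t =ᵐ[volume] 0 := by
      rw [h2] at h3
      exact h3.symm.trans (Lp.coeFn_zero _ _ _)
    refine sub_eq_zero.1 (VectorMeasure.ext fun A hA => ?_)
    rw [h1 A hA, setIntegral_congr_ae hA (h4.mono fun x hx _ => hx)]
    simp
  intro t ht
  refine signedMeasure_eq_of_forall_sintegral_eq fun φ => ?_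
  exact Measure.eqOn_Icc_of_ae_eq volume hT.ne
    (hz.mono fun s hs => congrArg (fun z => sintegral z φ) hs) (hz₁cont φ) (hz₂cont φ) ht
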